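/- There is an effective absolute constant C > 0 such that for every fundamental quadratic discriminant Δ < 0 with associated Kronecker symbol χ = (Δ/·), and every real x ≥ 2, the convergent infinite product satisfies ∏_{p > x, p prime} (1 − χ(p)/p) ≤ C · √|Δ|. -/

import Mathlib

/-- The Kronecker symbol `(Δ/p)` at a prime `p` (agreeing with the Legendre/Jacobi symbol at
odd primes, with the usual convention at `p = 2`). -/
def kroneckerAtPrime (Δ : ℤ) (p : ℕ) : ℤ :=
  if p = 2 then (if Δ % 2 = 0 then 0 else if Δ % 8 = 1 ∨ Δ % 8 = 7 then 1 else -1)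
  else jacobiSym Δ p

/-- `Δ` is a fundamental quadratic discriminant: either `Δ ≡ 1 (mod 4)` and squarefree,
or `Δ = 4m` with `m ≡ 2, 3 (mod 4)` squarefree. -/
def IsFundamentalDiscriminant (Δ : ℤ) : Prop :=
  (Δ % 4 = 1 ∧ Squarefree Δ) ∨
    (Δ % 4 = 0 ∧ Squarefree (Δ / 4) ∧ ((Δ / 4) % 4 = 2 ∨ (Δ / 4) % 4 = 3))

section TailProduct

open Finset Filter Topology

section DyadicBlocks

/-- A Chebyshev-type bound for the number of primes in a dyadic block. -/
theorem mul_card_primes_dyadic_le (j : ℕ) :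
    j * #{p ∈ Ico (2 ^ j) (2 ^ (j + 1)) | p.Prime} ≤ 4 * 2 ^ j := by
  set s := {p ∈ Ico (2 ^ j) (2 ^ (j + 1)) | p.Prime} with hs
  have h1 : (2 ^ j) ^ #s ≤ ∏ p ∈ s, p :=
    Finset.pow_card_le_prod s (fun p => p) (2 ^ j) fun p hp => by
      simp only [hs, mem_filter, mem_Ico] at hp
      exact hp.1.1
  have h2 : ∏ p ∈ s, p ≤ primorial (2 ^ (j + 1)) := by
    refine Finset.prod_le_prod_of_subset_of_one_le' ?_ ?_
    · intro p hp
      simp only [hs, mem_filter, mem_Ico, mem_range] at hp ⊢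
      exact ⟨by omega, hp.2⟩
    · intro p hp _
      exact (mem_filter.mp hp).2.one_lt.le
  have h3 : 2 ^ (j * #s) ≤ 2 ^ (4 * 2 ^ j) := by
    calc 2 ^ (j * #s) = (2 ^ j) ^ #s := by rw [pow_mul]
      _ ≤ 4 ^ (2 ^ (j + 1)) := (h1.trans h2).trans (primorial_le_four_pow _)
      _ = 2 ^ (4 * 2 ^ j) := by
        rw [show (4 : ℕ) = 2 ^ 2 by norm_num, ← pow_mul]
        congr 1
        ring
  exact (Nat.pow_le_pow_iff_right (by norm_num)).mp h3

theorem sum_inv_primes_dyadic_le (j : ℕ) :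
    ∑ p ∈ (Ico (2 ^ j) (2 ^ (j + 1)) : Finset ℕ) with p.Prime, (p : ℝ)⁻¹ ≤ 4 / j := by
  rcases Nat.eq_zero_or_pos j with rfl | hj
  · have : {p ∈ Ico (2 ^ 0) (2 ^ (0 + 1)) | p.Prime} = (∅ : Finset ℕ) := by decide
    rw [this]
    simp
  have h1 : ∑ p ∈ (Ico (2 ^ j) (2 ^ (j + 1)) : Finset ℕ) with p.Prime, (p : ℝ)⁻¹
      ≤ #{p ∈ Ico (2 ^ j) (2 ^ (j + 1)) | p.Prime} • ((2 : ℝ) ^ j)⁻¹ := by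
    refine Finset.sum_le_card_nsmul _ _ _ fun p hp => ?_
    simp only [mem_filter, mem_Ico] at hp
    gcongr
    exact_mod_cast hp.1.1
  have h2 : (j : ℝ) * #{p ∈ Ico (2 ^ j) (2 ^ (j + 1)) | p.Prime} ≤ 4 * 2 ^ j := by
    exact_mod_cast mul_card_primes_dyadic_le j
  have hj' : (0 : ℝ) < j := by exact_mod_cast hj
  refine h1.trans ?_
  rw [nsmul_eq_mul, ← div_eq_mul_inv, div_le_div_iff₀ (by positivity) hj']
  linarith

theorem sum_Ico_two_pow {M : Type*} [AddCommMonoid M] (f : ℕ → M) {a b : ℕ} (hab : a ≤ b) :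
    ∑ n ∈ Ico (2 ^ a) (2 ^ b), f n
      = ∑ j ∈ Ico a b, ∑ n ∈ Ico (2 ^ j) (2 ^ (j + 1)), f n := by
  induction b, hab using Nat.le_induction with
  | base => simp
  | succ b hab ih =>
    rw [Finset.sum_Ico_succ_top hab, ← ih, Finset.sum_Ico_consecutive _
      (Nat.pow_le_pow_right (by norm_num) hab) (Nat.pow_le_pow_right (by norm_num) (by omega))]

theorem log_two_of_mem_Ico {j n : ℕ} (hn : n ∈ Ico (2 ^ j) (2 ^ (j + 1))) : Nat.log 2 n = j := by
  rw [mem_Ico] at hn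
  exact Nat.log_eq_of_pow_le_of_lt_pow hn.1 hn.2

/-- Sums over primes of weights depending only on the dyadic block. -/
theorem sum_primes_weight_le (w : ℕ → ℝ) (hw : ∀ j, 0 ≤ w j) {a b : ℕ} (hab : a ≤ b) :
    ∑ p ∈ (Ico (2 ^ a) (2 ^ b) : Finset ℕ) with p.Prime, w (Nat.log 2 p) * (p : ℝ)⁻¹
      ≤ ∑ j ∈ Ico a b, w j * (4 / j) := by
  rw [Finset.sum_filter, sum_Ico_two_pow _ hab]
  refine Finset.sum_le_sum fun j _ => ?_
  rw [← Finset.sum_filter]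
  calc ∑ p ∈ (Ico (2 ^ j) (2 ^ (j + 1)) : Finset ℕ) with p.Prime, w (Nat.log 2 p) * (p : ℝ)⁻¹
      = w j * ∑ p ∈ (Ico (2 ^ j) (2 ^ (j + 1)) : Finset ℕ) with p.Prime, (p : ℝ)⁻¹ := by
        rw [Finset.mul_sum]
        refine Finset.sum_congr rfl fun p hp => ?_
        rw [log_two_of_mem_Ico (mem_filter.mp hp).1]
    _ ≤ w j * (4 / j) := mul_le_mul_of_nonneg_left (sum_inv_primes_dyadic_le j) (hw j)

end DyadicBlocks

section DyadicRoot

/-- The number `2 ^ (-1/J)`. -/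
noncomputable def dyadicRoot (J : ℕ) : ℝ := (2 : ℝ) ^ (-(1 / (J : ℝ)))

theorem dyadicRoot_pos (J : ℕ) : 0 < dyadicRoot J := Real.rpow_pos_of_pos (by norm_num) _

theorem dyadicRoot_pow_self {J : ℕ} (hJ : 1 ≤ J) : dyadicRoot J ^ J = 1 / 2 := by
  have : (J : ℝ) ≠ 0 := by positivity
  rw [dyadicRoot, ← Real.rpow_natCast, ← Real.rpow_mul (by norm_num)]
  rw [show -(1 / (J : ℝ)) * J = -1 by field_simp, Real.rpow_neg_one]
  norm_num

theorem dyadicRoot_le {J : ℕ} (hJ : 1 ≤ J) : dyadicRoot J ≤ 1 - 1 / (2 * J) := by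
  have hJ' : (1 : ℝ) ≤ J := by exact_mod_cast hJ
  have h1 : 1 / (2 * (J : ℝ)) ≤ 1 / 2 := by
    rw [div_le_div_iff₀ (by positivity) (by norm_num)]
    linarith
  refine le_of_pow_le_pow_left₀ (n := J) (by omega) (by linarith) ?_
  rw [dyadicRoot_pow_self hJ]
  have h := one_add_mul_le_pow (a := -(1 / (2 * (J : ℝ)))) (by linarith) J
  have h2 : (J : ℝ) * -(1 / (2 * (J : ℝ))) = -(1 / 2) := by field_simp
  rw [h2] at h
  calc (1 / 2 : ℝ) = 1 + -(1 / 2) := by norm_num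
    _ ≤ _ := h
    _ = _ := by ring_nf

theorem le_dyadicRoot {J : ℕ} (hJ : 1 ≤ J) : 1 - 1 / J ≤ dyadicRoot J := by
  have hJ' : (1 : ℝ) ≤ J := by exact_mod_cast hJ
  refine le_of_pow_le_pow_left₀ (n := J) (by omega) (dyadicRoot_pos J).le ?_
  rw [dyadicRoot_pow_self hJ]
  have h0 : 0 ≤ 1 - 1 / (J : ℝ) := by
    rw [sub_nonneg, div_le_one (by positivity)]
    exact hJ'
  have h1 : 1 - 1 / (J : ℝ) ≤ Real.exp (-(1 / J)) := by
    have := Real.add_one_le_exp (-(1 / (J : ℝ)))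
    linarith
  calc (1 - 1 / (J : ℝ)) ^ J ≤ Real.exp (-(1 / J)) ^ J := pow_le_pow_left₀ h0 h1 J
    _ = Real.exp (-1) := by
      rw [← Real.exp_nat_mul]
      congr 1
      field_simp
    _ ≤ 1 / 2 := by
      rw [Real.exp_neg, ← one_div]
      refine one_div_le_one_div_of_le (by norm_num) ?_
      have := Real.add_one_le_exp (1 : ℝ)
      linarith

theorem dyadicRoot_lt_one {J : ℕ} (hJ : 1 ≤ J) : dyadicRoot J < 1 := by
  have h := dyadicRoot_le hJ
  have : (0 : ℝ) < 1 / (2 * J) := by positivity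
  linarith

theorem half_le_dyadicRoot {J : ℕ} (hJ : 1 ≤ J) : 1 / 2 ≤ dyadicRoot J := by
  rw [← dyadicRoot_pow_self hJ]
  exact pow_le_of_le_one (dyadicRoot_pos J).le (dyadicRoot_lt_one hJ).le (by omega)

theorem sum_dyadicRoot_pow_le {J : ℕ} (hJ : 1 ≤ J) (s : Finset ℕ) :
    ∑ j ∈ s, dyadicRoot J ^ j ≤ 2 * J := by
  have h0 := (dyadicRoot_pos J).le
  have h1 := dyadicRoot_lt_one hJ
  have hJ' : (0 : ℝ) < J := by exact_mod_cast hJ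
  calc ∑ j ∈ s, dyadicRoot J ^ j ≤ ∑' j, dyadicRoot J ^ j :=
        (summable_geometric_of_lt_one h0 h1).sum_le_tsum _ fun _ _ => pow_nonneg h0 _
    _ = (1 - dyadicRoot J)⁻¹ := tsum_geometric_of_lt_one h0 h1
    _ ≤ (1 / (2 * (J : ℝ)))⁻¹ := by
      refine inv_anti₀ (by positivity) ?_
      linarith [dyadicRoot_le hJ]
    _ = 2 * J := by simp

theorem le_sum_dyadicRoot_pow {J : ℕ} (hJ : 1 ≤ J) :
    (J : ℝ) / 2 ≤ ∑ j ∈ range J, dyadicRoot J ^ j := by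
  have h1 := dyadicRoot_lt_one hJ
  have hJ' : (0 : ℝ) < J := by exact_mod_cast hJ
  have h2 := mul_neg_geom_sum (dyadicRoot J) J
  rw [dyadicRoot_pow_self hJ] at h2
  have h3 := le_dyadicRoot hJ
  have h4 : (0 : ℝ) ≤ ∑ j ∈ range J, dyadicRoot J ^ j :=
    Finset.sum_nonneg fun _ _ => pow_nonneg (dyadicRoot_pos J).le _
  have h5 : (1 - dyadicRoot J) * ∑ j ∈ range J, dyadicRoot J ^ j
      ≤ 1 / J * ∑ j ∈ range J, dyadicRoot J ^ j :=
    mul_le_mul_of_nonneg_right (by linarith) h4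
  rw [h2, div_mul_eq_mul_div, one_mul, le_div_iff₀ hJ'] at h5
  linarith

theorem one_sub_dyadicRoot_pow_le {J : ℕ} (hJ : 1 ≤ J) (k : ℕ) :
    1 - dyadicRoot J ^ k ≤ k / J := by
  have h := one_add_mul_le_pow (a := -(1 - dyadicRoot J))
    (by linarith [dyadicRoot_pos J]) k
  have h3 := le_dyadicRoot hJ
  have h4 : (k : ℝ) * (1 - dyadicRoot J) ≤ k * (1 / J) :=
    mul_le_mul_of_nonneg_left (by linarith) (by positivity)
  rw [show 1 + -(1 - dyadicRoot J) = dyadicRoot J by ring] at h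
  rw [div_eq_mul_one_div]
  linarith

theorem rpow_two_pow_eq (J j : ℕ) :
    ((2 ^ j : ℕ) : ℝ) ^ (-(1 / (J : ℝ))) = dyadicRoot J ^ j := by
  rw [dyadicRoot, ← Real.rpow_natCast, ← Real.rpow_mul (by norm_num)]
  push_cast
  rw [← Real.rpow_natCast, ← Real.rpow_mul (by norm_num), mul_comm]

theorem rpow_le_dyadicRoot_pow (J : ℕ) {j n : ℕ} (hn : 2 ^ j ≤ n) :
    (n : ℝ) ^ (-(1 / (J : ℝ))) ≤ dyadicRoot J ^ j := by
  rw [← rpow_two_pow_eq]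
  exact Real.rpow_le_rpow_of_nonpos (by positivity) (by exact_mod_cast hn)
    (by rw [neg_nonpos]; positivity)

theorem dyadicRoot_pow_le_rpow (J : ℕ) {j n : ℕ} (hn0 : 0 < n) (hn : n ≤ 2 ^ j) :
    dyadicRoot J ^ j ≤ (n : ℝ) ^ (-(1 / (J : ℝ))) := by
  rw [← rpow_two_pow_eq]
  exact Real.rpow_le_rpow_of_nonpos (by positivity) (by exact_mod_cast hn)
    (by rw [neg_nonpos]; positivity)

/-- The Dirichlet series weight `n ^ (-(1 + 1/J))`. -/
noncomputable def dyadicWeight (J n : ℕ) : ℝ := (n : ℝ) ^ (-(1 + 1 / (J : ℝ)))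

theorem dyadicWeight_nonneg (J n : ℕ) : 0 ≤ dyadicWeight J n := by
  unfold dyadicWeight
  positivity

theorem dyadicWeight_zero (J : ℕ) : dyadicWeight J 0 = 0 := by
  unfold dyadicWeight
  have : (0 : ℝ) ≤ 1 / J := by positivity
  rw [Nat.cast_zero, Real.zero_rpow (by linarith)]

theorem dyadicWeight_one (J : ℕ) : dyadicWeight J 1 = 1 := by
  simp [dyadicWeight]

theorem dyadicWeight_mul (J a b : ℕ) :
    dyadicWeight J (a * b) = dyadicWeight J a * dyadicWeight J b := by
  unfold dyadicWeight
  push_cast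
  exact Real.mul_rpow (by positivity) (by positivity)

theorem dyadicWeight_eq (J : ℕ) {n : ℕ} (hn : 0 < n) :
    dyadicWeight J n = (n : ℝ) ^ (-(1 / (J : ℝ))) * (n : ℝ)⁻¹ := by
  unfold dyadicWeight
  rw [← Real.rpow_neg_one (n : ℝ), ← Real.rpow_add (by exact_mod_cast hn)]
  ring_nf

theorem dyadicWeight_le_inv (J n : ℕ) : dyadicWeight J n ≤ (n : ℝ)⁻¹ := by
  rcases Nat.eq_zero_or_pos n with rfl | hn
  · simp [dyadicWeight_zero]
  rw [dyadicWeight_eq J hn]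
  refine mul_le_of_le_one_left (by positivity) ?_
  simpa using rpow_le_dyadicRoot_pow J (j := 0) (n := n) (by simpa using Nat.succ_le_of_lt hn)

theorem dyadicWeight_antitone (J : ℕ) {a b : ℕ} (ha : 0 < a) (hab : a ≤ b) :
    dyadicWeight J b ≤ dyadicWeight J a :=
  Real.rpow_le_rpow_of_nonpos (by exact_mod_cast ha) (by exact_mod_cast hab)
    (by rw [neg_nonpos]; positivity)

theorem summable_dyadicWeight {J : ℕ} (hJ : 1 ≤ J) : Summable (dyadicWeight J) := by
  have : (0 : ℝ) < 1 / J := by positivity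
  exact Real.summable_nat_rpow.mpr (by linarith)

theorem dyadicWeight_le_block (J : ℕ) {j n : ℕ} (hn : n ∈ Ico (2 ^ j) (2 ^ (j + 1))) :
    dyadicWeight J n ≤ dyadicRoot J ^ j * ((2 : ℝ) ^ j)⁻¹ := by
  rw [mem_Ico] at hn
  rw [dyadicWeight_eq J (lt_of_lt_of_le (by positivity) hn.1)]
  refine mul_le_mul (rpow_le_dyadicRoot_pow J hn.1) ?_ (by positivity)
    (pow_nonneg (dyadicRoot_pos J).le _)
  gcongr
  exact_mod_cast hn.1

theorem block_le_dyadicWeight (J : ℕ) {j n : ℕ} (hn : n ∈ Ico (2 ^ j) (2 ^ (j + 1))) :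
    dyadicRoot J ^ (j + 1) * ((2 : ℝ) ^ (j + 1))⁻¹ ≤ dyadicWeight J n := by
  rw [mem_Ico] at hn
  have hn0 : 0 < n := lt_of_lt_of_le (by positivity) hn.1
  rw [dyadicWeight_eq J hn0]
  refine mul_le_mul (dyadicRoot_pow_le_rpow J hn0 hn.2.le) ?_ (by positivity) (by positivity)
  have : (0 : ℝ) < n := by exact_mod_cast hn0
  gcongr
  exact_mod_cast hn.2.le

theorem tsum_dyadicWeight_le {J : ℕ} (hJ : 1 ≤ J) : ∑' n, dyadicWeight J n ≤ 2 * J := by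
  refine Real.tsum_le_of_sum_range_le (dyadicWeight_nonneg J) fun N => ?_
  have hN : range N ⊆ range (2 ^ N) := by
    rw [range_subset_range]
    exact N.lt_two_pow_self.le
  calc ∑ n ∈ range N, dyadicWeight J n ≤ ∑ n ∈ range (2 ^ N), dyadicWeight J n :=
        Finset.sum_le_sum_of_subset_of_nonneg hN fun _ _ _ => dyadicWeight_nonneg _ _
    _ = ∑ n ∈ Ico (2 ^ 0) (2 ^ N), dyadicWeight J n := by
        rw [range_eq_Ico, ← Finset.sum_Ico_consecutive _ (Nat.zero_le 1) Nat.one_le_two_pow]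
        simp [dyadicWeight_zero]
    _ = ∑ j ∈ Ico 0 N, ∑ n ∈ Ico (2 ^ j) (2 ^ (j + 1)), dyadicWeight J n :=
        sum_Ico_two_pow _ (Nat.zero_le N)
    _ ≤ ∑ j ∈ Ico 0 N, dyadicRoot J ^ j := by
        refine Finset.sum_le_sum fun j _ => ?_
        refine (Finset.sum_le_card_nsmul _ _ _ fun n hn => dyadicWeight_le_block J hn).trans ?_
        rw [Nat.card_Ico, nsmul_eq_mul, show 2 ^ (j + 1) - 2 ^ j = 2 ^ j by rw [pow_succ]; omega]
        push_cast
        rw [mul_left_comm, mul_inv_cancel₀ (by positivity), mul_one]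
    _ ≤ 2 * J := sum_dyadicRoot_pow_le hJ _

theorem le_tsum_dyadicWeight {J : ℕ} (hJ : 1 ≤ J) : (J : ℝ) / 8 ≤ ∑' n, dyadicWeight J n := by
  have h1 : ∑ n ∈ Ico (2 ^ 0) (2 ^ J), dyadicWeight J n ≤ ∑' n, dyadicWeight J n :=
    (summable_dyadicWeight hJ).sum_le_tsum _ fun _ _ => dyadicWeight_nonneg _ _
  refine le_trans ?_ h1
  rw [sum_Ico_two_pow _ (Nat.zero_le J), ← range_eq_Ico]
  calc (J : ℝ) / 8 ≤ 1 / 4 * ∑ j ∈ range J, dyadicRoot J ^ j := by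
        linarith [le_sum_dyadicRoot_pow hJ]
    _ = ∑ j ∈ range J, 1 / 4 * dyadicRoot J ^ j := Finset.mul_sum _ _ _
    _ ≤ _ := by
        refine Finset.sum_le_sum fun j _ => ?_
        refine le_trans ?_ (Finset.card_nsmul_le_sum _ _ _
          fun n hn => block_le_dyadicWeight J hn)
        rw [Nat.card_Ico, nsmul_eq_mul, show 2 ^ (j + 1) - 2 ^ j = 2 ^ j by rw [pow_succ]; omega]
        push_cast
        have h2 := half_le_dyadicRoot hJ
        have h3 : 0 < dyadicRoot J ^ j := pow_pos (dyadicRoot_pos J) j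
        rw [show (2 : ℝ) ^ j * (dyadicRoot J ^ (j + 1) * (2 ^ (j + 1))⁻¹)
          = dyadicRoot J ^ j * dyadicRoot J / 2 by field_simp; ring]
        nlinarith

end DyadicRoot

section EulerProductComparison

variable (χ : ℕ →*₀ ℝ)

/-- The twist of `χ` by `n ^ (-(1 + 1/J))`. -/
noncomputable def twist (J : ℕ) : ℕ →*₀ ℝ where
  toFun n := χ n * dyadicWeight J n
  map_zero' := by simp
  map_one' := by simp [dyadicWeight_one]
  map_mul' a b := by rw [map_mul, dyadicWeight_mul]; ring

theorem twist_apply (J n : ℕ) : twist χ J n = χ n * dyadicWeight J n := rfl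

/-- The value at `1 + 1/J` of the Dirichlet series of `χ`. -/
noncomputable def lValue (J : ℕ) : ℝ := ∑' n, χ n * dyadicWeight J n

/-- The truncated product `∏_{p < N} (1 - χ(p)/p)`. -/
noncomputable def truncProd (N : ℕ) : ℝ := ∏ p ∈ N.primesBelow, (1 - χ p / p)

variable {χ}

theorem summable_abs_twist (hχ : ∀ n, |χ n| ≤ 1) {J : ℕ} (hJ : 1 ≤ J) :
    Summable fun n => ‖twist χ J n‖ := by
  refine (summable_dyadicWeight hJ).of_nonneg_of_le (fun _ => norm_nonneg _) fun n => ?_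
  rw [twist_apply, norm_mul, Real.norm_eq_abs, Real.norm_eq_abs,
    abs_of_nonneg (dyadicWeight_nonneg J n)]
  exact mul_le_of_le_one_left (dyadicWeight_nonneg J n) (hχ n)

theorem tendsto_eulerProduct (hχ : ∀ n, |χ n| ≤ 1) {J : ℕ} (hJ : 1 ≤ J) :
    Tendsto (fun N : ℕ => ∏ p ∈ N.primesBelow, (1 - twist χ J p)⁻¹) atTop (𝓝 (lValue χ J)) :=
  EulerProduct.eulerProduct_completely_multiplicative (summable_abs_twist hχ hJ)

theorem inv_prime_le_half {p : ℕ} (hp : p.Prime) : (p : ℝ)⁻¹ ≤ 1 / 2 := by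
  have : (2 : ℝ) ≤ p := by exact_mod_cast hp.two_le
  rw [← one_div]
  exact one_div_le_one_div_of_le (by norm_num) this

theorem half_le_one_sub {c t : ℝ} (hc : |c| ≤ 1) (ht0 : 0 ≤ t) (ht : t ≤ 1 / 2) :
    1 / 2 ≤ 1 - c * t := by
  nlinarith [abs_le.mp hc]

theorem ratio_le_exp {a b w : ℝ} (hb : 1 / 2 ≤ b) (h : |a - b| ≤ w) :
    a * b⁻¹ ≤ Real.exp (2 * w) := by
  have hw : 0 ≤ w := (abs_nonneg _).trans h
  have h1 : a * b⁻¹ ≤ 1 + 2 * w := by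
    rw [← div_eq_mul_inv, div_le_iff₀ (by linarith)]
    nlinarith [abs_le.mp h]
  linarith [Real.add_one_le_exp (2 * w)]

theorem truncProd_pos (hχ : ∀ n, |χ n| ≤ 1) (N : ℕ) : 0 < truncProd χ N := by
  refine Finset.prod_pos fun p hp => ?_
  have h := half_le_one_sub (hχ p) (by positivity)
    (inv_prime_le_half (Nat.prime_of_mem_primesBelow hp))
  rw [div_eq_mul_inv]
  linarith

/-- The perturbation weight comparing the truncated Euler product at `1` with the full Euler
product at `1 + 1/J`. -/
noncomputable def compWeight (J j : ℕ) : ℝ :=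
  if j < J then 2 * j / J else dyadicRoot J ^ j

theorem compWeight_nonneg (J j : ℕ) : 0 ≤ compWeight J j := by
  unfold compWeight
  split_ifs
  · positivity
  · exact pow_nonneg (dyadicRoot_pos J).le _

theorem sum_compWeight_le {J : ℕ} (hJ : 1 ≤ J) (K : ℕ) :
    ∑ j ∈ range K, compWeight J j * (4 / j) ≤ 16 := by
  have hJ' : (0 : ℝ) < J := by exact_mod_cast hJ
  have h1 : ∀ j ∈ range K, compWeight J j * (4 / j)
      ≤ (if j < J then 8 / (J : ℝ) else 0) + 4 / J * dyadicRoot J ^ j := by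
    intro j _
    have h0 : 0 ≤ 4 / (J : ℝ) * dyadicRoot J ^ j :=
      mul_nonneg (by positivity) (pow_nonneg (dyadicRoot_pos J).le _)
    unfold compWeight
    split_ifs with hj
    · rcases Nat.eq_zero_or_pos j with rfl | hj0
      · simp
        positivity
      have hj0' : (0 : ℝ) < j := by exact_mod_cast hj0
      have : 2 * (j : ℝ) / J * (4 / j) = 8 / J := by field_simp; ring
      linarith
    · rw [zero_add, mul_comm]
      refine mul_le_mul_of_nonneg_right ?_ (pow_nonneg (dyadicRoot_pos J).le _)
      have : (J : ℝ) ≤ j := by exact_mod_cast not_lt.mp hj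
      gcongr
  refine (Finset.sum_le_sum h1).trans ?_
  rw [Finset.sum_add_distrib, ← Finset.mul_sum, ← Finset.sum_filter, Finset.sum_const,
    nsmul_eq_mul]
  have h2 : (#{j ∈ range K | j < J} : ℝ) ≤ J := by
    have : {j ∈ range K | j < J} ⊆ range J := fun j hj => by
      simp only [mem_filter, mem_range] at hj ⊢
      exact hj.2
    exact_mod_cast (card_le_card this).trans_eq (card_range J)
  have h3 : (#{j ∈ range K | j < J} : ℝ) * (8 / J) ≤ J * (8 / J) :=
    mul_le_mul_of_nonneg_right h2 (by positivity)
  have h4 : 4 / (J : ℝ) * ∑ j ∈ range K, dyadicRoot J ^ j ≤ 4 / J * (2 * J) :=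
    mul_le_mul_of_nonneg_left (sum_dyadicRoot_pow_le hJ _) (by positivity)
  have h5 : (J : ℝ) * (8 / J) = 8 := by field_simp
  have h6 : 4 / (J : ℝ) * (2 * J) = 8 := by field_simp; ring
  linarith

/-- The factor at `p` of the product up to `2 ^ J`. -/
theorem abs_factor_sub_le (hχ : ∀ n, |χ n| ≤ 1) {J : ℕ} (hJ : 1 ≤ J) {p : ℕ} (hp : p.Prime) :
    |(if p < 2 ^ J then 1 - χ p / p else 1) - (1 - twist χ J p)|
      ≤ compWeight J (Nat.log 2 p) * (p : ℝ)⁻¹ := by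
  have hJ' : (0 : ℝ) < J := by exact_mod_cast hJ
  have hlog : p < 2 ^ J ↔ Nat.log 2 p < J :=
    (Nat.log_lt_iff_lt_pow (by norm_num) hp.ne_zero).symm
  have hmem : p ∈ Ico (2 ^ Nat.log 2 p) (2 ^ (Nat.log 2 p + 1)) := by
    rw [mem_Ico]
    exact ⟨Nat.pow_log_le_self 2 hp.ne_zero, Nat.lt_pow_succ_log_self (by norm_num) p⟩
  set j := Nat.log 2 p with hj
  have hj1 : 1 ≤ j := Nat.log_pos (by norm_num) hp.two_le
  unfold compWeight
  have hp0 : (0 : ℝ) < (p : ℝ)⁻¹ := by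
    have := hp.pos
    positivity
  by_cases h : p < 2 ^ J
  · rw [if_pos h, if_pos (hlog.mp h), twist_apply]
    rw [show 1 - χ p / p - (1 - χ p * dyadicWeight J p)
      = χ p * (dyadicWeight J p - (p : ℝ)⁻¹) by rw [div_eq_mul_inv]; ring, abs_mul]
    refine (mul_le_of_le_one_left (abs_nonneg _) (hχ p)).trans ?_
    rw [abs_sub_comm, abs_of_nonneg (sub_nonneg.mpr (dyadicWeight_le_inv J p)),
      dyadicWeight_eq J hp.pos]
    have h1 := dyadicRoot_pow_le_rpow J hp.pos (mem_Ico.mp hmem).2.le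
    have h2 := one_sub_dyadicRoot_pow_le hJ (j + 1)
    have h3 : ((j + 1 : ℕ) : ℝ) / J ≤ 2 * j / J := by
      refine div_le_div_of_nonneg_right ?_ hJ'.le
      have : (1 : ℝ) ≤ j := by exact_mod_cast hj1
      push_cast
      linarith
    nlinarith
  · rw [if_neg h, if_neg (fun h' => h (hlog.mpr h')), twist_apply]
    rw [sub_sub_cancel, abs_mul, abs_of_nonneg (dyadicWeight_nonneg J p)]
    refine (mul_le_of_le_one_left (dyadicWeight_nonneg J p) (hχ p)).trans ?_
    rw [dyadicWeight_eq J hp.pos]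
    exact mul_le_mul_of_nonneg_right (rpow_le_dyadicRoot_pow J (mem_Ico.mp hmem).1) hp0.le

theorem sum_compWeight_primes_le {J : ℕ} (hJ : 1 ≤ J) (K : ℕ) :
    ∑ p ∈ (2 ^ K).primesBelow, compWeight J (Nat.log 2 p) * (p : ℝ)⁻¹ ≤ 16 := by
  refine le_trans (le_of_eq ?_) ((sum_primes_weight_le (compWeight J) (compWeight_nonneg J)
    (Nat.zero_le K)).trans (by rw [← range_eq_Ico]; exact sum_compWeight_le hJ K))
  refine Finset.sum_congr ?_ fun _ _ => rfl
  ext p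
  simp only [Nat.mem_primesBelow, mem_filter, mem_Ico, pow_zero]
  exact ⟨fun h => ⟨⟨h.2.pos, h.1⟩, h.2⟩, fun h => ⟨h.1.2, h.2⟩⟩

theorem truncProd_eq_prod_ite {J K : ℕ} (hJK : J ≤ K) :
    truncProd χ (2 ^ J)
      = ∏ p ∈ (2 ^ K).primesBelow, (if p < 2 ^ J then 1 - χ p / p else 1) := by
  rw [truncProd, ← Finset.prod_filter]
  refine Finset.prod_congr ?_ fun _ _ => rfl
  have : 2 ^ J ≤ 2 ^ K := Nat.pow_le_pow_right (by norm_num) hJK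
  ext p
  simp only [Nat.mem_primesBelow, mem_filter]
  exact ⟨fun h => ⟨⟨by omega, h.2⟩, h.1⟩, fun h => ⟨h.2, h.1.2⟩⟩

theorem half_le_one_sub_twist (hχ : ∀ n, |χ n| ≤ 1) (J : ℕ) {p : ℕ} (hp : p.Prime) :
    1 / 2 ≤ 1 - twist χ J p :=
  half_le_one_sub (hχ p) (dyadicWeight_nonneg J p)
    ((dyadicWeight_le_inv J p).trans (inv_prime_le_half hp))

theorem half_le_ite (hχ : ∀ n, |χ n| ≤ 1) (J : ℕ) {p : ℕ} (hp : p.Prime) :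
    1 / 2 ≤ (if p < 2 ^ J then 1 - χ p / p else 1) := by
  split_ifs
  · rw [div_eq_mul_inv (χ p)]
    exact half_le_one_sub (hχ p) (by positivity) (inv_prime_le_half hp)
  · norm_num

theorem tendsto_two_pow_nat : Tendsto (fun K : ℕ => 2 ^ K) atTop atTop :=
  tendsto_pow_atTop_atTop_of_one_lt (by norm_num : 1 < 2)

theorem truncProd_mul_lValue_le (hχ : ∀ n, |χ n| ≤ 1) {J : ℕ} (hJ : 1 ≤ J) :
    truncProd χ (2 ^ J) * lValue χ J ≤ Real.exp 32 := by
  have hlim := ((tendsto_eulerProduct hχ hJ).comp tendsto_two_pow_nat).const_mul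
    (truncProd χ (2 ^ J))
  refine le_of_tendsto hlim ?_
  filter_upwards [eventually_ge_atTop J] with K hK
  rw [Function.comp_apply, truncProd_eq_prod_ite hK, ← Finset.prod_mul_distrib]
  calc _ ≤ ∏ p ∈ (2 ^ K).primesBelow,
        Real.exp (2 * (compWeight J (Nat.log 2 p) * (p : ℝ)⁻¹)) := by
        refine Finset.prod_le_prod (fun p hp => ?_) fun p hp => ?_
        · have hp' := Nat.prime_of_mem_primesBelow hp
          have h1 := half_le_one_sub_twist hχ J hp'
          have h2 := half_le_ite hχ J hp'
          exact mul_nonneg (by linarith) (inv_nonneg.mpr (by linarith))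
        · have hp' := Nat.prime_of_mem_primesBelow hp
          exact ratio_le_exp (half_le_one_sub_twist hχ J hp') (abs_factor_sub_le hχ hJ hp')
    _ = Real.exp (2 * ∑ p ∈ (2 ^ K).primesBelow, compWeight J (Nat.log 2 p) * (p : ℝ)⁻¹) := by
        rw [← Real.exp_sum, Finset.mul_sum]
    _ ≤ Real.exp 32 := by
        rw [Real.exp_le_exp]
        linarith [sum_compWeight_primes_le hJ K]

theorem one_le_truncProd_mul_lValue (hχ : ∀ n, |χ n| ≤ 1) {J : ℕ} (hJ : 1 ≤ J) :
    1 ≤ Real.exp 32 * (truncProd χ (2 ^ J) * lValue χ J) := by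
  have hlim := (((tendsto_eulerProduct hχ hJ).comp tendsto_two_pow_nat).const_mul
    (truncProd χ (2 ^ J))).const_mul (Real.exp 32)
  refine ge_of_tendsto hlim ?_
  filter_upwards [eventually_ge_atTop J] with K hK
  rw [Function.comp_apply, truncProd_eq_prod_ite hK, ← Finset.prod_mul_distrib]
  set T := ∏ p ∈ (2 ^ K).primesBelow,
    ((if p < 2 ^ J then 1 - χ p / p else 1) * (1 - twist χ J p)⁻¹) with hT
  have hTpos : 0 < T := by
    refine Finset.prod_pos fun p hp => ?_
    have hp' := Nat.prime_of_mem_primesBelow hp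
    have h1 := half_le_one_sub_twist hχ J hp'
    have h2 := half_le_ite hχ J hp'
    exact mul_pos (by linarith) (inv_pos.mpr (by linarith))
  have h : T⁻¹ ≤ Real.exp 32 := by
    rw [hT, ← Finset.prod_inv_distrib]
    calc _ ≤ ∏ p ∈ (2 ^ K).primesBelow,
          Real.exp (2 * (compWeight J (Nat.log 2 p) * (p : ℝ)⁻¹)) := by
          refine Finset.prod_le_prod (fun p hp => ?_) fun p hp => ?_
          · have hp' := Nat.prime_of_mem_primesBelow hp
            have h1 := half_le_one_sub_twist hχ J hp'
            have h2 := half_le_ite hχ J hp'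
            exact inv_nonneg.mpr (mul_nonneg (by linarith) (inv_nonneg.mpr (by linarith)))
          · have hp' := Nat.prime_of_mem_primesBelow hp
            rw [mul_inv, inv_inv, mul_comm]
            refine ratio_le_exp (half_le_ite hχ J hp') ?_
            rw [abs_sub_comm]
            exact abs_factor_sub_le hχ hJ hp'
      _ = Real.exp (2 * ∑ p ∈ (2 ^ K).primesBelow, compWeight J (Nat.log 2 p) * (p : ℝ)⁻¹) := by
          rw [← Real.exp_sum, Finset.mul_sum]
      _ ≤ Real.exp 32 := by
          rw [Real.exp_le_exp]
          linarith [sum_compWeight_primes_le hJ K]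
  calc (1 : ℝ) = T⁻¹ * T := (inv_mul_cancel₀ hTpos.ne').symm
    _ ≤ Real.exp 32 * T := mul_le_mul_of_nonneg_right h hTpos.le

end EulerProductComparison

section PartialSummation

theorem abs_sum_mul_antitone_le {f a : ℕ → ℝ} {q : ℝ}
    (hq : ∀ N, |∑ d ∈ range N, f d| ≤ q) {M N : ℕ} (hMN : M ≤ N)
    (ha : ∀ d, M ≤ d → a (d + 1) ≤ a d) (ha0 : ∀ d, M ≤ d → 0 ≤ a d) :
    |∑ d ∈ Ico M N, f d * a d| ≤ 2 * q * a M := by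
  have hG : ∀ n, M ≤ n → |∑ d ∈ Ico M n, f d| ≤ 2 * q := fun n hn => by
    rw [Finset.sum_Ico_eq_sub _ hn]
    exact (abs_sub _ _).trans (by linarith [hq n, hq M])
  have key : |∑ d ∈ Ico M N, f d * a d - (∑ d ∈ Ico M N, f d) * a N| ≤ 2 * q * (a M - a N) := by
    induction N, hMN using Nat.le_induction with
    | base => simp
    | succ n hn ih =>
      rw [Finset.sum_Ico_succ_top hn, Finset.sum_Ico_succ_top hn]
      have h1 : ∑ d ∈ Ico M n, f d * a d + f n * a n - (∑ d ∈ Ico M n, f d + f n) * a (n + 1)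
          = (∑ d ∈ Ico M n, f d * a d - (∑ d ∈ Ico M n, f d) * a n)
            + (∑ d ∈ Ico M (n + 1), f d) * (a n - a (n + 1)) := by
        rw [Finset.sum_Ico_succ_top hn]
        ring
      have h2 : |(∑ d ∈ Ico M (n + 1), f d) * (a n - a (n + 1))| ≤ 2 * q * (a n - a (n + 1)) := by
        rw [abs_mul, abs_of_nonneg (sub_nonneg.mpr (ha n hn))]
        exact mul_le_mul_of_nonneg_right (hG _ (by omega)) (sub_nonneg.mpr (ha n hn))
      rw [h1]
      refine (abs_add_le _ _).trans ?_
      linarith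
  have h3 : |(∑ d ∈ Ico M N, f d) * a N| ≤ 2 * q * a N := by
    rw [abs_mul, abs_of_nonneg (ha0 N hMN)]
    exact mul_le_mul_of_nonneg_right (hG N hMN) (ha0 N hMN)
  have h4 := abs_add_le (∑ d ∈ Ico M N, f d * a d - (∑ d ∈ Ico M N, f d) * a N)
    ((∑ d ∈ Ico M N, f d) * a N)
  rw [sub_add_cancel] at h4
  linarith

variable {χ : ℕ →*₀ ℝ} {q ℓ : ℝ}

theorem abs_sum_mul_inv_le (hq : ∀ N, |∑ d ∈ range N, χ d| ≤ q) {M N : ℕ} (hM : 1 ≤ M)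
    (hMN : M ≤ N) : |∑ d ∈ Ico M N, χ d * (d : ℝ)⁻¹| ≤ 2 * q * (M : ℝ)⁻¹ := by
  refine abs_sum_mul_antitone_le (a := fun d => (d : ℝ)⁻¹) hq hMN (fun d hd => ?_)
    fun d _ => by positivity
  have : (0 : ℝ) < d := by exact_mod_cast (lt_of_lt_of_le hM hd)
  gcongr
  simp

theorem exists_tendsto_sum_mul_inv (hq : ∀ N, |∑ d ∈ range N, χ d| ≤ q) :
    ∃ ℓ, Tendsto (fun N : ℕ => ∑ d ∈ range N, χ d * (d : ℝ)⁻¹) atTop (𝓝 ℓ) := by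
  refine cauchySeq_tendsto_of_complete ?_
  rw [← cauchySeq_shift 1]
  refine cauchySeq_of_le_tendsto_0' (fun M : ℕ => 2 * q * ((M + 1 : ℕ) : ℝ)⁻¹) ?_ ?_
  · intro M N hMN
    rw [dist_comm, Real.dist_eq, ← Finset.sum_Ico_eq_sub _ (by omega)]
    exact abs_sum_mul_inv_le hq (by omega) (by omega)
  · have h := (tendsto_inv_atTop_nhds_zero_nat (𝕜 := ℝ)).comp (tendsto_add_atTop_nat 1)
    simpa using h.const_mul (2 * q)

theorem abs_limit_sub_sum_le (hq : ∀ N, |∑ d ∈ range N, χ d| ≤ q)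
    (hℓ : Tendsto (fun N : ℕ => ∑ d ∈ range N, χ d * (d : ℝ)⁻¹) atTop (𝓝 ℓ))
    {M : ℕ} (hM : 1 ≤ M) :
    |ℓ - ∑ d ∈ range M, χ d * (d : ℝ)⁻¹| ≤ 2 * q * (M : ℝ)⁻¹ := by
  refine le_of_tendsto (hℓ.sub_const _).abs ?_
  filter_upwards [eventually_ge_atTop M] with N hN
  rw [← Finset.sum_Ico_eq_sub _ hN]
  exact abs_sum_mul_inv_le hq hM hN

theorem summable_mul_dyadicWeight (hχ : ∀ n, |χ n| ≤ 1) {J : ℕ} (hJ : 1 ≤ J) :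
    Summable fun n => χ n * dyadicWeight J n :=
  (summable_abs_twist hχ hJ).of_norm

theorem abs_lValue_sub_sum_le (hχ : ∀ n, |χ n| ≤ 1) (hq : ∀ N, |∑ d ∈ range N, χ d| ≤ q)
    {M J : ℕ} (hM : 1 ≤ M) (hJ : 1 ≤ J) :
    |lValue χ J - ∑ d ∈ range M, χ d * dyadicWeight J d| ≤ 2 * q * (M : ℝ)⁻¹ := by
  have hlim := (summable_mul_dyadicWeight hχ hJ).hasSum.tendsto_sum_nat
  refine le_of_tendsto (hlim.sub_const _).abs ?_
  filter_upwards [eventually_ge_atTop M] with N hN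
  rw [← Finset.sum_Ico_eq_sub _ hN]
  refine (abs_sum_mul_antitone_le (a := dyadicWeight J) hq hN
    (fun d hd => dyadicWeight_antitone J (by omega) (by omega))
    fun d _ => dyadicWeight_nonneg J d).trans ?_
  have hq0 : 0 ≤ q := (abs_nonneg _).trans (hq 0)
  exact mul_le_mul_of_nonneg_left (dyadicWeight_le_inv J M) (by positivity)

theorem tendsto_dyadicWeight (n : ℕ) :
    Tendsto (fun J => dyadicWeight J n) atTop (𝓝 (n : ℝ)⁻¹) := by
  rcases Nat.eq_zero_or_pos n with rfl | hn
  · simp [dyadicWeight_zero]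
  have h1 : Tendsto (fun J : ℕ => -(1 + 1 / (J : ℝ))) atTop (𝓝 (-(1 + 0))) :=
    (tendsto_const_nhds.add tendsto_one_div_atTop_nhds_zero_nat).neg
  have h2 := Tendsto.rpow (tendsto_const_nhds (x := (n : ℝ)) (f := atTop)) h1
    (Or.inl (by positivity))
  rw [add_zero, Real.rpow_neg_one] at h2
  exact h2

theorem tendsto_lValue (hχ : ∀ n, |χ n| ≤ 1) (hq : ∀ N, |∑ d ∈ range N, χ d| ≤ q)
    (hℓ : Tendsto (fun N : ℕ => ∑ d ∈ range N, χ d * (d : ℝ)⁻¹) atTop (𝓝 ℓ)) :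
    Tendsto (lValue χ) atTop (𝓝 ℓ) := by
  rw [Metric.tendsto_atTop]
  intro ε hε
  have h0 : Tendsto (fun M : ℕ => 2 * q * (M : ℝ)⁻¹) atTop (𝓝 0) := by
    simpa using (tendsto_inv_atTop_nhds_zero_nat (𝕜 := ℝ)).const_mul (2 * q)
  obtain ⟨M, hM1, hM⟩ := ((eventually_ge_atTop 1).and
    (h0.eventually (gt_mem_nhds (show (0 : ℝ) < ε / 3 by linarith)))).exists
  have h1 : Tendsto (fun J => ∑ d ∈ range M, χ d * dyadicWeight J d) atTop
      (𝓝 (∑ d ∈ range M, χ d * (d : ℝ)⁻¹)) :=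
    tendsto_finsetSum _ fun d _ => (tendsto_dyadicWeight d).const_mul _
  obtain ⟨J₀, hJ₀⟩ := Metric.tendsto_atTop.mp h1 (ε / 3) (by linarith)
  refine ⟨max J₀ 1, fun J hJ => ?_⟩
  have h2 := hJ₀ J ((le_max_left _ _).trans hJ)
  have h3 := abs_lValue_sub_sum_le hχ hq hM1 ((le_max_right _ _).trans hJ)
  have h4 := abs_limit_sub_sum_le hq hℓ hM1
  rw [Real.dist_eq] at h2 ⊢
  rw [abs_lt] at h2 ⊢
  rw [abs_le] at h3 h4
  constructor <;> linarith [h2.1, h2.2, h3.1, h3.2, h4.1, h4.2]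

end PartialSummation

section DivisorSums

/-- The convolution `1 * χ`. -/
noncomputable def divisorSum (χ : ℕ →*₀ ℝ) (n : ℕ) : ℝ := ∑ d ∈ n.divisors, χ d

/-- `χ` as an arithmetic function. -/
noncomputable def toArith (χ : ℕ →*₀ ℝ) : ArithmeticFunction ℝ := ⟨χ, map_zero χ⟩

/-- The summatory function of `1 * χ`. -/
noncomputable def divisorSummatory (χ : ℕ →*₀ ℝ) (y : ℕ) : ℝ := ∑ n ∈ Ioc 0 y, divisorSum χ n

variable {χ : ℕ →*₀ ℝ} {q ℓ : ℝ}

theorem toArith_mul_zeta (n : ℕ) :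
    (toArith χ * (ArithmeticFunction.zeta : ArithmeticFunction ℝ)) n = divisorSum χ n := by
  rw [ArithmeticFunction.coe_mul_zeta_apply]
  rfl

theorem divisorSummatory_eq (y : ℕ) {N : ℕ} (hN : y < N) :
    divisorSummatory χ y = ∑ d ∈ range N, χ d * ((y / d : ℕ) : ℝ) := by
  have h := ArithmeticFunction.sum_Ioc_mul_zeta_eq_sum (toArith χ) y
  simp only [toArith_mul_zeta] at h
  rw [divisorSummatory, h]
  refine Finset.sum_subset (fun d hd => ?_) fun d _ hd => ?_
  · simp only [mem_Ioc, mem_range] at hd ⊢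
    omega
  · simp only [mem_Ioc, not_and_or, not_lt, not_le] at hd
    have : y / d = 0 := by
      rcases hd with hd | hd
      · rw [Nat.le_zero.mp hd, Nat.div_zero]
      · exact Nat.div_eq_of_lt hd
    rw [this]
    simp

theorem divisorSummatory_le (hχ : ∀ n, |χ n| ≤ 1) (hq : ∀ N, |∑ d ∈ range N, χ d| ≤ q)
    (hℓ : Tendsto (fun N : ℕ => ∑ d ∈ range N, χ d * (d : ℝ)⁻¹) atTop (𝓝 ℓ))
    (y : ℕ) {D : ℕ} (hD : 1 ≤ D) :
    divisorSummatory χ y ≤ y * (ℓ + 4 * q / D) + D := by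
  have hD' : (0 : ℝ) < D := by exact_mod_cast hD
  have hq0 : 0 ≤ q := (abs_nonneg _).trans (hq 0)
  rw [divisorSummatory_eq y (show y < y + D + 1 by omega),
    ← Finset.sum_range_add_sum_Ico _ (show D ≤ y + D + 1 by omega)]
  have h1 : ∑ d ∈ range D, χ d * ((y / d : ℕ) : ℝ)
      ≤ ∑ d ∈ range D, (y * (χ d * (d : ℝ)⁻¹) + 1) := by
    refine Finset.sum_le_sum fun d _ => ?_
    have h2 : ((y / d : ℕ) : ℝ) ≤ y * (d : ℝ)⁻¹ := by
      rw [← div_eq_mul_inv]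
      exact Nat.cast_div_le
    have h3 : (y : ℝ) * (d : ℝ)⁻¹ - 1 ≤ ((y / d : ℕ) : ℝ) := by
      rw [← div_eq_mul_inv]
      have := Nat.lt_floor_add_one ((y : ℝ) / d)
      rw [Nat.floor_div_eq_div] at this
      linarith
    have h4 := abs_le.mp (hχ d)
    nlinarith
  have h5 : |∑ d ∈ Ico D (y + D + 1), χ d * ((y / d : ℕ) : ℝ)| ≤ 2 * q * ((y / D : ℕ) : ℝ) :=
    abs_sum_mul_antitone_le (a := fun d => ((y / d : ℕ) : ℝ)) hq (by omega)
      (fun d hd => by exact_mod_cast Nat.div_le_div_left (Nat.le_succ d) (by omega))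
      fun d _ => by positivity
  have h6 : 2 * q * ((y / D : ℕ) : ℝ) ≤ 2 * q * (y / D) :=
    mul_le_mul_of_nonneg_left Nat.cast_div_le (by positivity)
  have h7 := abs_le.mp (abs_limit_sub_sum_le hq hℓ hD)
  rw [Finset.sum_add_distrib, ← Finset.mul_sum, Finset.sum_const, card_range, nsmul_eq_mul,
    mul_one] at h1
  have h8 : (y : ℝ) * ∑ d ∈ range D, χ d * (d : ℝ)⁻¹ ≤ y * (ℓ + 2 * q * (D : ℝ)⁻¹) :=
    mul_le_mul_of_nonneg_left (by linarith) (by positivity)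
  have h9 : (y : ℝ) * (ℓ + 4 * q / D) + D
      = y * (ℓ + 2 * q * (D : ℝ)⁻¹) + D + 2 * q * (y / D) := by
    field_simp
    ring
  linarith [abs_le.mp h5]

theorem hasSum_divisorSum_mul (hχ : ∀ n, |χ n| ≤ 1) {J : ℕ} (hJ : 1 ≤ J) :
    HasSum (fun n => divisorSum χ n * dyadicWeight J n)
      (lValue χ J * ∑' n, dyadicWeight J n) := by
  have hs1 : Summable fun n => ‖χ n * dyadicWeight J n‖ := summable_abs_twist hχ hJ
  have hs2 : Summable fun n => ‖dyadicWeight J n‖ := (summable_dyadicWeight hJ).norm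
  have h := (summable_mul_of_summable_norm hs1 hs2).hasSum.tsum_fiberwise
    (fun x : ℕ × ℕ => x.1 * x.2)
  rw [← tsum_mul_tsum_of_summable_norm hs1 hs2] at h
  suffices e : (fun n => divisorSum χ n * dyadicWeight J n) =
      fun n => ∑' b : ↑((fun x : ℕ × ℕ => x.1 * x.2) ⁻¹' {n}),
        χ b.1.1 * dyadicWeight J b.1.1 * dyadicWeight J b.1.2 by
    rw [e]
    exact h
  funext n
  rcases Nat.eq_zero_or_pos n with rfl | hn
  · rw [dyadicWeight_zero, mul_zero]
    symm
    refine (tsum_congr fun b => ?_).trans tsum_zero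
    have hb : b.1.1 * b.1.2 = 0 := b.2
    rw [mul_assoc, ← dyadicWeight_mul, hb, dyadicWeight_zero, mul_zero]
  · have hset : (fun x : ℕ × ℕ => x.1 * x.2) ⁻¹' {n} = (n.divisorsAntidiagonal : Set (ℕ × ℕ)) := by
      ext x
      simp [Nat.mem_divisorsAntidiagonal, hn.ne']
    rw [hset, Finset.tsum_subtype' n.divisorsAntidiagonal
      (fun x : ℕ × ℕ => χ x.1 * dyadicWeight J x.1 * dyadicWeight J x.2), divisorSum,
      Finset.sum_mul, ← Nat.sum_divisorsAntidiagonal fun d _ => χ d * dyadicWeight J n]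
    refine Finset.sum_congr rfl fun x hx => ?_
    rw [mul_assoc, ← dyadicWeight_mul, (Nat.mem_divisorsAntidiagonal.mp hx).1]

theorem lValue_nonneg (hχ : ∀ n, |χ n| ≤ 1) {J : ℕ} (hJ : 1 ≤ J) : 0 ≤ lValue χ J := by
  by_contra! h
  have h1 := one_le_truncProd_mul_lValue hχ hJ
  have h2 := mul_neg_of_pos_of_neg (truncProd_pos hχ (2 ^ J)) h
  have h3 := mul_neg_of_pos_of_neg (Real.exp_pos 32) h2
  linarith

theorem lValue_le_of_summatory_le (hχ : ∀ n, |χ n| ≤ 1) (hr : ∀ n, 0 ≤ divisorSum χ n)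
    {B : ℝ} (hB : 0 ≤ B) {J₀ J : ℕ} (hJ₀ : 1 ≤ J₀) (hJ : J₀ ≤ J)
    (hA : ∀ y, 2 ^ J₀ ≤ y → divisorSummatory χ y ≤ B * y) :
    lValue χ J ≤ 32 * (lValue χ J₀ + B) := by
  have hJ1 : 1 ≤ J := hJ₀.trans hJ
  have hJ' : (0 : ℝ) < J := by exact_mod_cast hJ1
  have hterm : ∀ I n, 0 ≤ divisorSum χ n * dyadicWeight I n := fun I n =>
    mul_nonneg (hr n) (dyadicWeight_nonneg I n)
  have hhead : ∑ n ∈ range (2 ^ J₀), divisorSum χ n * dyadicWeight J n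
      ≤ 4 * J₀ * lValue χ J₀ := by
    calc ∑ n ∈ range (2 ^ J₀), divisorSum χ n * dyadicWeight J n
        ≤ ∑ n ∈ range (2 ^ J₀), 2 * (divisorSum χ n * dyadicWeight J₀ n) := by
          refine Finset.sum_le_sum fun n hn => ?_
          rw [mul_left_comm]
          refine mul_le_mul_of_nonneg_left ?_ (hr n)
          rcases Nat.eq_zero_or_pos n with rfl | hn0
          · simp [dyadicWeight_zero]
          refine (dyadicWeight_le_inv J n).trans ?_
          rw [dyadicWeight_eq J₀ hn0]
          have h1 := dyadicRoot_pow_le_rpow J₀ hn0 (mem_range.mp hn).le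
          rw [dyadicRoot_pow_self hJ₀] at h1
          have h2 : (0 : ℝ) < (n : ℝ)⁻¹ := by positivity
          nlinarith
      _ = 2 * ∑ n ∈ range (2 ^ J₀), divisorSum χ n * dyadicWeight J₀ n :=
          (Finset.mul_sum _ _ _).symm
      _ ≤ 2 * (lValue χ J₀ * ∑' n, dyadicWeight J₀ n) := by
          refine mul_le_mul_of_nonneg_left ?_ (by norm_num)
          exact sum_le_hasSum _ (fun n _ => hterm J₀ n) (hasSum_divisorSum_mul hχ hJ₀)
      _ ≤ 2 * (lValue χ J₀ * (2 * J₀)) := by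
          refine mul_le_mul_of_nonneg_left ?_ (by norm_num)
          exact mul_le_mul_of_nonneg_left (tsum_dyadicWeight_le hJ₀) (lValue_nonneg hχ hJ₀)
      _ = 4 * J₀ * lValue χ J₀ := by ring
  have htail : ∀ K, J₀ ≤ K →
      ∑ n ∈ Ico (2 ^ J₀) (2 ^ K), divisorSum χ n * dyadicWeight J n ≤ 4 * B * J := by
    intro K hK
    rw [sum_Ico_two_pow _ hK]
    calc _ ≤ ∑ j ∈ Ico J₀ K, 2 * B * dyadicRoot J ^ j := by
          refine Finset.sum_le_sum fun j hj => ?_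
          have hθ : 0 ≤ dyadicRoot J ^ j * ((2 : ℝ) ^ j)⁻¹ :=
            mul_nonneg (pow_nonneg (dyadicRoot_pos J).le _) (by positivity)
          calc ∑ n ∈ Ico (2 ^ j) (2 ^ (j + 1)), divisorSum χ n * dyadicWeight J n
              ≤ ∑ n ∈ Ico (2 ^ j) (2 ^ (j + 1)),
                divisorSum χ n * (dyadicRoot J ^ j * ((2 : ℝ) ^ j)⁻¹) :=
                Finset.sum_le_sum fun n hn =>
                  mul_le_mul_of_nonneg_left (dyadicWeight_le_block J hn) (hr n)
            _ = (∑ n ∈ Ico (2 ^ j) (2 ^ (j + 1)), divisorSum χ n)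
                * (dyadicRoot J ^ j * ((2 : ℝ) ^ j)⁻¹) := (Finset.sum_mul _ _ _).symm
            _ ≤ divisorSummatory χ (2 ^ (j + 1)) * (dyadicRoot J ^ j * ((2 : ℝ) ^ j)⁻¹) := by
                refine mul_le_mul_of_nonneg_right ?_ hθ
                refine Finset.sum_le_sum_of_subset_of_nonneg (fun n hn => ?_) fun n _ _ => hr n
                have : 0 < 2 ^ j := by positivity
                rw [mem_Ico] at hn
                rw [mem_Ioc]
                omega
            _ ≤ B * ((2 ^ (j + 1) : ℕ) : ℝ) * (dyadicRoot J ^ j * ((2 : ℝ) ^ j)⁻¹) := by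
                refine mul_le_mul_of_nonneg_right (hA _ ?_) hθ
                have := (mem_Ico.mp hj).1
                exact Nat.pow_le_pow_right (by norm_num) (by omega)
            _ = 2 * B * dyadicRoot J ^ j := by
                push_cast
                field_simp
                ring
      _ = 2 * B * ∑ j ∈ Ico J₀ K, dyadicRoot J ^ j := (Finset.mul_sum _ _ _).symm
      _ ≤ 2 * B * (2 * J) :=
          mul_le_mul_of_nonneg_left (sum_dyadicRoot_pow_le hJ1 _) (by positivity)
      _ = 4 * B * J := by ring
  have htotal : lValue χ J * ∑' n, dyadicWeight J n ≤ 4 * J₀ * lValue χ J₀ + 4 * B * J := by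
    have hlim := (hasSum_divisorSum_mul hχ hJ1).tendsto_sum_nat.comp tendsto_two_pow_nat
    refine le_of_tendsto hlim ?_
    filter_upwards [eventually_ge_atTop J₀] with K hK
    rw [Function.comp_apply, ← Finset.sum_range_add_sum_Ico _
      (Nat.pow_le_pow_right (show 0 < 2 by norm_num) hK)]
    exact add_le_add hhead (htail K hK)
  have h1 : lValue χ J * (J / 8) ≤ lValue χ J * ∑' n, dyadicWeight J n :=
    mul_le_mul_of_nonneg_left (le_tsum_dyadicWeight hJ1) (lValue_nonneg hχ hJ1)
  have h2 : 4 * (J₀ : ℝ) * lValue χ J₀ ≤ 4 * J * lValue χ J₀ := by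
    refine mul_le_mul_of_nonneg_right ?_ (lValue_nonneg hχ hJ₀)
    have : (J₀ : ℝ) ≤ J := by exact_mod_cast hJ
    linarith
  have h3 : lValue χ J * J ≤ 32 * (lValue χ J₀ + B) * J := by nlinarith
  exact le_of_mul_le_mul_right h3 hJ'

end DivisorSums

section OddSymbol

/-- The Jacobi symbol `(Δ/n)`, extended by zero to even `n`. -/
noncomputable def oddSymbol (Δ : ℤ) : ℕ →*₀ ℝ where
  toFun n := if Odd n then (jacobiSym Δ n : ℝ) else 0
  map_zero' := by simp
  map_one' := by simp
  map_mul' a b := by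
    by_cases ha : Odd a
    · by_cases hb : Odd b
      · have : NeZero a := ⟨ha.pos.ne'⟩
        have : NeZero b := ⟨hb.pos.ne'⟩
        simp only [ha, hb, ha.mul hb, if_true, jacobiSym.mul_right]
        push_cast
        rfl
      · simp [Nat.odd_mul, hb]
    · simp [Nat.odd_mul, ha]

variable {Δ : ℤ}

theorem oddSymbol_of_odd {n : ℕ} (hn : Odd n) : oddSymbol Δ n = (jacobiSym Δ n : ℝ) :=
  if_pos hn

theorem oddSymbol_of_not_odd {n : ℕ} (hn : ¬ Odd n) : oddSymbol Δ n = 0 :=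
  if_neg hn

theorem oddSymbol_trichotomy (Δ : ℤ) (n : ℕ) :
    oddSymbol Δ n = 0 ∨ oddSymbol Δ n = 1 ∨ oddSymbol Δ n = -1 := by
  by_cases hn : Odd n
  · rw [oddSymbol_of_odd hn]
    rcases jacobiSym.trichotomy Δ n with h | h | h <;> simp [h]
  · exact Or.inl (oddSymbol_of_not_odd hn)

theorem abs_oddSymbol_le_one (Δ : ℤ) (n : ℕ) : |oddSymbol Δ n| ≤ 1 := by
  rcases oddSymbol_trichotomy Δ n with h | h | h <;> simp [h]

theorem oddSymbol_add_period (n : ℕ) :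
    oddSymbol Δ (4 * Δ.natAbs + n) = oddSymbol Δ n := by
  by_cases hn : Odd n
  · have hn' : Odd (4 * Δ.natAbs + n) := by
      rw [Nat.odd_iff] at hn ⊢
      omega
    rw [oddSymbol_of_odd hn, oddSymbol_of_odd hn', jacobiSym.mod_right Δ hn',
      Nat.add_mod_left, ← jacobiSym.mod_right Δ hn]
  · have hn' : ¬ Odd (4 * Δ.natAbs + n) := by
      rw [Nat.odd_iff] at hn ⊢
      omega
    rw [oddSymbol_of_not_odd hn, oddSymbol_of_not_odd hn']

theorem jacobiSym_period_sub_one (hΔ : Δ < 0) : jacobiSym Δ (4 * Δ.natAbs - 1) = -1 := by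
  set m := Δ.natAbs with hm
  have hm0 : 0 < m := Int.natAbs_pos.mpr hΔ.ne
  have hodd : Odd (4 * m - 1) := by
    rw [Nat.odd_iff]
    omega
  have h1 : Δ = -(m : ℤ) := by omega
  have h2 : jacobiSym (4 * (m : ℤ)) (4 * m - 1) = 1 := by
    rw [jacobiSym.mod_left' (a₂ := 1), jacobiSym.one_left]
    have : ((4 * m - 1 : ℕ) : ℤ) = 4 * m - 1 := by omega
    rw [this]
    exact Int.ModEq.symm (Int.modEq_iff_dvd.mpr ⟨1, by ring⟩)
  rw [jacobiSym.mul_left, jacobiSym.at_four hodd, one_mul] at h2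
  rw [h1, jacobiSym.neg _ hodd, h2, mul_one, ZMod.χ₄_nat_three_mod_four]
  omega

theorem oddSymbol_period_sub (hΔ : Δ < 0) {n : ℕ} (hn : n < 4 * Δ.natAbs) (hn0 : 0 < n) :
    oddSymbol Δ (4 * Δ.natAbs - n) = -oddSymbol Δ n := by
  have h4 := jacobiSym_period_sub_one hΔ
  set q := 4 * Δ.natAbs with hq
  by_cases ho : Odd n
  · have ho' : Odd (q - n) := by
      rw [Nat.odd_iff] at ho ⊢
      omega
    have ho1 : Odd (q - 1) := by
      rw [Nat.odd_iff]
      omega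
    have hmod : n * (q - 1) % q = (q - n) % q := by
      refine Nat.ModEq.symm (Nat.modEq_iff_dvd.mpr ⟨(n : ℤ) - 1, ?_⟩)
      rw [Nat.cast_mul, Nat.cast_sub (by omega), Nat.cast_sub (by omega)]
      push_cast
      ring
    have hmul : oddSymbol Δ (n * (q - 1)) = oddSymbol Δ (q - n) := by
      rw [oddSymbol_of_odd (ho.mul ho1), oddSymbol_of_odd ho', jacobiSym.mod_right Δ (ho.mul ho1),
        jacobiSym.mod_right Δ ho', ← hq, hmod]
    rw [← hmul, map_mul, oddSymbol_of_odd ho1, h4]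
    simp
  · have ho' : ¬ Odd (q - n) := by
      rw [Nat.odd_iff] at ho ⊢
      omega
    rw [oddSymbol_of_not_odd ho, oddSymbol_of_not_odd ho', neg_zero]

theorem sum_oddSymbol_period (hΔ : Δ < 0) : ∑ n ∈ range (4 * Δ.natAbs), oddSymbol Δ n = 0 := by
  have hm0 : 0 < Δ.natAbs := Int.natAbs_pos.mpr hΔ.ne
  have h := fun n (hn : n < 4 * Δ.natAbs) (hn0 : 0 < n) => oddSymbol_period_sub hΔ hn hn0
  obtain ⟨r, hr⟩ : ∃ r, 4 * Δ.natAbs = r + 1 := ⟨4 * Δ.natAbs - 1, by omega⟩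
  rw [hr] at h ⊢
  rw [Finset.sum_range_succ', map_zero, add_zero]
  have h1 := Finset.sum_range_reflect (fun n => oddSymbol Δ (n + 1)) r
  have h2 : ∑ j ∈ range r, oddSymbol Δ (r - 1 - j + 1) = -∑ j ∈ range r, oddSymbol Δ (j + 1) := by
    rw [← Finset.sum_neg_distrib]
    refine Finset.sum_congr rfl fun j hj => ?_
    have hj' := mem_range.mp hj
    rw [← h (j + 1) (by omega) (by omega)]
    congr 1
    omega
  linarith

theorem abs_sum_oddSymbol_le (hΔ : Δ < 0) (N : ℕ) :
    |∑ n ∈ range N, oddSymbol Δ n| ≤ 4 * (Δ.natAbs : ℝ) := by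
  have hm0 : 0 < Δ.natAbs := Int.natAbs_pos.mpr hΔ.ne
  induction N using Nat.strong_induction_on with
  | _ N ih =>
    rcases lt_or_ge N (4 * Δ.natAbs) with hN | hN
    · refine (Finset.abs_sum_le_sum_abs _ _).trans ?_
      refine (Finset.sum_le_sum fun n _ => abs_oddSymbol_le_one Δ n).trans ?_
      rw [Finset.sum_const, card_range, nsmul_eq_mul, mul_one]
      exact_mod_cast hN.le
    · obtain ⟨k, rfl⟩ := Nat.exists_eq_add_of_le hN
      rw [Finset.sum_range_add, sum_oddSymbol_period hΔ, zero_add]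
      simp only [oddSymbol_add_period]
      exact ih k (by omega)

end OddSymbol

section Roots

theorem divisorSum_mul {χ : ℕ →*₀ ℝ} {a b : ℕ} (hab : a.Coprime b) :
    divisorSum χ (a * b) = divisorSum χ a * divisorSum χ b := by
  have h1 : (toArith χ).IsMultiplicative :=
    ⟨map_one χ, fun {m n} _ => map_mul χ m n⟩
  have h2 := (h1.mul ArithmeticFunction.isMultiplicative_zeta.natCast).map_mul_of_coprime hab
  simpa only [toArith_mul_zeta] using h2

theorem divisorSum_prime_pow {χ : ℕ →*₀ ℝ} {p : ℕ} (hp : p.Prime) (k : ℕ) :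
    divisorSum χ (p ^ k) = ∑ i ∈ range (k + 1), χ p ^ i := by
  rw [divisorSum, Nat.sum_divisors_prime_pow hp]
  simp

theorem divisorSum_one (χ : ℕ →*₀ ℝ) : divisorSum χ 1 = 1 := by
  simp [divisorSum]

theorem divisorSum_zero (χ : ℕ →*₀ ℝ) : divisorSum χ 0 = 0 := by
  simp [divisorSum]

theorem sum_range_neg_one_pow_nonneg (k : ℕ) : 0 ≤ ∑ i ∈ range k, (-1 : ℝ) ^ i := by
  rw [neg_one_geom_sum]
  split_ifs <;> norm_num

theorem divisorSum_oddSymbol_nonneg (Δ : ℤ) (n : ℕ) : 0 ≤ divisorSum (oddSymbol Δ) n := by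
  induction n using Nat.recOnPosPrimePosCoprime with
  | prime_pow p k hp hk =>
    rw [divisorSum_prime_pow hp]
    rcases oddSymbol_trichotomy Δ p with h | h | h
    · rw [h]
      exact Finset.sum_nonneg fun i _ => by positivity
    · rw [h]
      exact Finset.sum_nonneg fun i _ => by positivity
    · rw [h]
      exact sum_range_neg_one_pow_nonneg _
  | zero => rw [divisorSum_zero]
  | one => rw [divisorSum_one]; norm_num
  | coprime a b _ _ hab iha ihb =>
    rw [divisorSum_mul hab]
    exact mul_nonneg iha ihb

/-- The residues `t` modulo `n` with `t ^ 2 ≡ Δ`. -/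
def squareRoots (Δ : ℤ) (n : ℕ) : Finset ℕ := {t ∈ range n | (n : ℤ) ∣ (t : ℤ) ^ 2 - Δ}

variable {Δ : ℤ}

theorem mem_squareRoots {n t : ℕ} :
    t ∈ squareRoots Δ n ↔ t < n ∧ (n : ℤ) ∣ (t : ℤ) ^ 2 - Δ := by
  simp [squareRoots]

theorem mod_mem_squareRoots {a n t : ℕ} (ha : 0 < a) (han : a ∣ n) (ht : t ∈ squareRoots Δ n) :
    t % a ∈ squareRoots Δ a := by
  rw [mem_squareRoots] at ht ⊢
  refine ⟨Nat.mod_lt _ ha, ?_⟩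
  have h1 : (a : ℤ) ∣ (t : ℤ) ^ 2 - Δ := (Int.natCast_dvd_natCast.mpr han).trans ht.2
  have h2 : (a : ℤ) ∣ (t : ℤ) - ((t % a : ℕ) : ℤ) := by
    push_cast
    exact Int.dvd_self_sub_emod
  have h3 : ((t % a : ℕ) : ℤ) ^ 2 - Δ =
      ((t : ℤ) ^ 2 - Δ) - ((t : ℤ) - ((t % a : ℕ) : ℤ)) * ((t : ℤ) + ((t % a : ℕ) : ℤ)) := by ring
  rw [h3]
  exact h1.sub (h2.mul_right _)

theorem card_squareRoots_mul_le {a b : ℕ} (ha : 0 < a) (hb : 0 < b) (hab : a.Coprime b) :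
    #(squareRoots Δ (a * b)) ≤ #(squareRoots Δ a) * #(squareRoots Δ b) := by
  rw [← Finset.card_product]
  refine Finset.card_le_card_of_injOn (fun t => (t % a, t % b)) (fun t ht => ?_) ?_
  · exact Finset.mem_product.mpr ⟨mod_mem_squareRoots ha (dvd_mul_right a b) ht,
      mod_mem_squareRoots hb (dvd_mul_left b a) ht⟩
  · intro t ht s hs h
    simp only [Prod.mk.injEq] at h
    have h1 := (Nat.modEq_and_modEq_iff_modEq_mul hab).mp ⟨h.1, h.2⟩
    exact h1.eq_of_lt_of_lt (mem_squareRoots.mp ht).1 (mem_squareRoots.mp hs).1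

theorem card_squareRoots_prime_pow_le_two {p k : ℕ} (hp : p.Prime) (hp2 : p ≠ 2)
    (hpΔ : ¬ (p : ℤ) ∣ Δ) : #(squareRoots Δ (p ^ k)) ≤ 2 := by
  rcases Nat.eq_zero_or_pos k with rfl | hk
  · refine (Finset.card_filter_le _ _).trans ?_
    simp
  rcases (squareRoots Δ (p ^ k)).eq_empty_or_nonempty with h | ⟨t, ht⟩
  · simp [h]
  refine (Finset.card_le_card (t := {t, p ^ k - t}) fun s hs => ?_).trans Finset.card_le_two
  rw [mem_squareRoots] at ht hs
  have hpp : Prime (p : ℤ) := Nat.prime_iff_prime_int.mp hp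
  have hpk : (p : ℤ) ∣ ((p ^ k : ℕ) : ℤ) := by
    exact_mod_cast dvd_pow_self p hk.ne'
  have hprod : ((p ^ k : ℕ) : ℤ) ∣ ((t : ℤ) - s) * ((t : ℤ) + s) := by
    rw [show ((t : ℤ) - s) * ((t : ℤ) + s) = ((t : ℤ) ^ 2 - Δ) - ((s : ℤ) ^ 2 - Δ) by ring]
    exact ht.2.sub hs.2
  have hnot : ¬ ((p : ℤ) ∣ (t : ℤ) - s ∧ (p : ℤ) ∣ (t : ℤ) + s) := by
    rintro ⟨h1, h2⟩
    have h3 : (p : ℤ) ∣ 2 * t := by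
      rw [show 2 * (t : ℤ) = ((t : ℤ) - s) + ((t : ℤ) + s) by ring]
      exact h1.add h2
    rcases hpp.dvd_or_dvd h3 with h4 | h4
    · have : p ∣ 2 := by exact_mod_cast h4
      exact hp2 ((Nat.prime_dvd_prime_iff_eq hp Nat.prime_two).mp this)
    · have h5 := (hpk.trans ht.2)
      have h6 : (p : ℤ) ∣ (t : ℤ) ^ 2 := dvd_pow h4 two_ne_zero
      exact hpΔ ((dvd_sub_right h6).mp h5)
  have hor : ((p ^ k : ℕ) : ℤ) ∣ (t : ℤ) - s ∨ ((p ^ k : ℕ) : ℤ) ∣ (t : ℤ) + s := by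
    rw [not_and_or] at hnot
    rcases hnot with h | h
    · right
      refine IsCoprime.dvd_of_dvd_mul_left ?_ hprod
      push_cast
      exact ((Prime.coprime_iff_not_dvd hpp).mpr h).pow_left
    · left
      refine IsCoprime.dvd_of_dvd_mul_right ?_ hprod
      push_cast
      exact ((Prime.coprime_iff_not_dvd hpp).mpr h).pow_left
  rw [Finset.mem_insert, Finset.mem_singleton]
  generalize p ^ k = P at ht hs hor
  rcases hor with h | h
  · left
    have := (Nat.modEq_iff_dvd.mpr h).eq_of_lt_of_lt hs.1 ht.1
    exact this
  · have h' : P ∣ t + s := by exact_mod_cast h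
    obtain ⟨c, hc⟩ := h'
    have hc2 : c < 2 := by
      by_contra! h2
      have := Nat.mul_le_mul_left P h2
      omega
    interval_cases c
    · left; omega
    · right; omega

theorem card_squareRoots_prime_pow_le {p k : ℕ} (hp : p.Prime) (hp2 : p ≠ 2) (hk : 0 < k)
    (hsq : ¬ (p : ℤ) ^ 2 ∣ Δ) :
    (#(squareRoots Δ (p ^ k)) : ℝ) ≤ divisorSum (oddSymbol Δ) (p ^ k) := by
  have : Fact p.Prime := ⟨hp⟩
  have hpp : Prime (p : ℤ) := Nat.prime_iff_prime_int.mp hp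
  have hpk : (p : ℤ) ∣ ((p ^ k : ℕ) : ℤ) := by
    exact_mod_cast dvd_pow_self p hk.ne'
  have hodd : Odd p := hp.odd_of_ne_two hp2
  rcases jacobiSym.trichotomy Δ p with h | h | h
  · have hdvd : (p : ℤ) ∣ Δ := by
      rw [← jacobiSym.legendreSym.to_jacobiSym, legendreSym.eq_zero_iff] at h
      exact (ZMod.intCast_zmod_eq_zero_iff_dvd _ _).mp h
    have hdiv : divisorSum (oddSymbol Δ) (p ^ k) = 1 := by
      rw [divisorSum_prime_pow hp, oddSymbol_of_odd hodd, h, Int.cast_zero,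
        Finset.sum_range_succ']
      simp
    have hdt : ∀ t ∈ squareRoots Δ (p ^ k), (p : ℤ) ∣ t := fun t ht => by
      have h1 := hpk.trans (mem_squareRoots.mp ht).2
      exact hpp.dvd_of_dvd_pow ((dvd_sub_left hdvd).mp h1)
    rw [hdiv]
    rcases Nat.lt_or_ge k 2 with hk2 | hk2
    · obtain rfl : k = 1 := by omega
      have : #(squareRoots Δ (p ^ 1)) ≤ 1 := by
        refine (Finset.card_le_card (t := {0}) fun t ht => ?_).trans (by simp)
        have h1 := hdt t ht
        have h2 := (mem_squareRoots.mp ht).1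
        rw [pow_one] at h2
        rw [Finset.mem_singleton]
        exact Nat.eq_zero_of_dvd_of_lt (by exact_mod_cast h1) h2
      exact_mod_cast this
    · have : squareRoots Δ (p ^ k) = ∅ := by
        refine Finset.eq_empty_of_forall_notMem fun t ht => hsq ?_
        have h1 : (p : ℤ) ^ 2 ∣ ((p ^ k : ℕ) : ℤ) := by
          push_cast
          exact pow_dvd_pow _ hk2
        have h2 := h1.trans (mem_squareRoots.mp ht).2
        exact (dvd_sub_right (pow_dvd_pow_of_dvd (hdt t ht) 2)).mp h2
      rw [this]
      norm_num
  · have hnd : ¬ (p : ℤ) ∣ Δ := fun hd => by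
      rw [← jacobiSym.legendreSym.to_jacobiSym] at h
      have := (legendreSym.eq_zero_iff p Δ).mpr ((ZMod.intCast_zmod_eq_zero_iff_dvd _ _).mpr hd)
      rw [this] at h
      norm_num at h
    have h1 : (#(squareRoots Δ (p ^ k)) : ℝ) ≤ 2 := by
      exact_mod_cast card_squareRoots_prime_pow_le_two hp hp2 hnd
    have hk' : (1 : ℝ) ≤ k := by exact_mod_cast hk
    rw [divisorSum_prime_pow hp, oddSymbol_of_odd hodd, h]
    simp
    linarith
  · have : squareRoots Δ (p ^ k) = ∅ := by
      refine Finset.eq_empty_of_forall_notMem fun t ht => ?_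
      have h1 := hpk.trans (mem_squareRoots.mp ht).2
      have h2 := (jacobiSym.prime_dvd_of_eq_neg_one h (x := t) (y := 1) (by simpa using h1)).2
      exact hpp.not_isUnit (isUnit_of_dvd_one h2)
    rw [this, Finset.card_empty, Nat.cast_zero]
    exact divisorSum_oddSymbol_nonneg _ _

theorem card_squareRoots_le (hsq : ∀ p : ℕ, p.Prime → p ≠ 2 → ¬ (p : ℤ) ^ 2 ∣ Δ) {n : ℕ}
    (hn : Odd n) : (#(squareRoots Δ n) : ℝ) ≤ divisorSum (oddSymbol Δ) n := by
  induction n using Nat.recOnPosPrimePosCoprime with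
  | prime_pow p k hp hk =>
    have hp2 : p ≠ 2 := by
      rintro rfl
      exact absurd hn (by rw [Nat.not_odd_iff_even]; exact (even_two.pow_of_ne_zero hk.ne'))
    exact card_squareRoots_prime_pow_le hp hp2 hk (hsq p hp hp2)
  | zero => simp at hn
  | one =>
    rw [divisorSum_one]
    have := Finset.card_filter_le (range 1) fun t : ℕ => ((1 : ℕ) : ℤ) ∣ (t : ℤ) ^ 2 - Δ
    rw [card_range] at this
    exact_mod_cast this
  | coprime a b ha hb hab iha ihb =>
    rw [Nat.odd_mul] at hn
    rw [divisorSum_mul hab]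
    refine le_trans ?_ (mul_le_mul (iha hn.1) (ihb hn.2) (by positivity)
      (divisorSum_oddSymbol_nonneg _ _))
    exact_mod_cast card_squareRoots_mul_le (by omega) (by omega) hab

theorem IsFundamentalDiscriminant.not_sq_dvd (h : IsFundamentalDiscriminant Δ) {p : ℕ}
    (hp : p.Prime) (hp2 : p ≠ 2) : ¬ (p : ℤ) ^ 2 ∣ Δ := by
  have hpp : Prime (p : ℤ) := Nat.prime_iff_prime_int.mp hp
  intro hd
  rcases h with ⟨_, hs⟩ | ⟨h4, hs, _⟩
  · exact hpp.not_isUnit (hs p (by rwa [← sq]))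
  · refine hpp.not_isUnit (hs p ?_)
    rw [← sq]
    have h1 : Δ = 4 * (Δ / 4) := by omega
    rw [h1] at hd
    refine IsCoprime.dvd_of_dvd_mul_left ?_ hd
    have h2 : Nat.Coprime (p ^ 2) (2 ^ 2) :=
      Nat.Coprime.pow _ _ ((Nat.coprime_primes hp Nat.prime_two).mpr hp2)
    have h3 := Nat.isCoprime_iff_coprime.mpr h2
    push_cast at h3
    exact h3

end Roots

section FormCounting

/-- The value at `(u, v)` of the binary quadratic form `a X ^ 2 + 2 b X Y + c Y ^ 2`. -/
def formValue (a b c u v : ℕ) : ℕ := a * u ^ 2 + 2 * b * u * v + c * v ^ 2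

theorem formValue_mul (a b c g u v : ℕ) :
    formValue a b c (g * u) (g * v) = g ^ 2 * formValue a b c u v := by
  unfold formValue
  ring

theorem odd_formValue {a b c u v : ℕ} (ha : Odd a) (hu : Odd u) (hv : Even v) :
    Odd (formValue a b c u v) := by
  unfold formValue
  refine ((ha.mul hu.pow).add_even ?_).add_even ?_
  · exact hv.mul_left _
  · exact (hv.pow_of_ne_zero two_ne_zero).mul_left _

variable {Δ : ℤ}

theorem exists_mem_squareRoots {a b c u v : ℕ} (h : (b : ℤ) ^ 2 - Δ = a * c) (huv : u.Coprime v)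
    (hpos : 0 < formValue a b c u v) :
    ∃ t ∈ squareRoots Δ (formValue a b c u v),
      (formValue a b c u v : ℤ) ∣ v * t + (a * u + b * v) := by
  obtain ⟨x, y, hxy⟩ := Nat.isCoprime_iff_coprime.mpr huv
  have hn : (formValue a b c u v : ℤ) = a * u ^ 2 + 2 * b * u * v + c * v ^ 2 := by
    unfold formValue
    push_cast
    ring
  generalize formValue a b c u v = n at hn hpos ⊢
  have hn0 : (0 : ℤ) < n := by exact_mod_cast hpos
  set t₀ : ℤ := -y * (a * u + b * v) + x * (b * u + c * v) with ht₀
  have hcast : ((t₀ % n).toNat : ℤ) = t₀ % n := Int.toNat_of_nonneg (Int.emod_nonneg _ hn0.ne')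
  have hsub : (n : ℤ) ∣ t₀ - t₀ % n := Int.dvd_self_sub_emod
  refine ⟨(t₀ % n).toNat, mem_squareRoots.mpr ⟨?_, ?_⟩, ?_⟩
  · have := Int.emod_lt_of_pos t₀ hn0
    omega
  · rw [hcast]
    have h1 : (n : ℤ) ∣ t₀ ^ 2 - Δ := by
      refine ⟨a * y ^ 2 - 2 * b * x * y + c * x ^ 2, ?_⟩
      rw [hn, ht₀]
      linear_combination (Δ * (x * u + y * v + 1)) * hxy
        + (x * u + y * v) ^ 2 * h
    rw [show (t₀ % n) ^ 2 - Δ = (t₀ ^ 2 - Δ) - (t₀ - t₀ % n) * (t₀ + t₀ % n) by ring]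
    exact h1.sub (hsub.mul_right _)
  · rw [hcast]
    have h1 : (n : ℤ) ∣ v * t₀ + (a * u + b * v) := by
      refine ⟨x, ?_⟩
      rw [hn, ht₀]
      linear_combination (-((a : ℤ) * u + b * v)) * hxy
    rw [show (v : ℤ) * (t₀ % n) + (a * u + b * v) =
      (v * t₀ + (a * u + b * v)) - (t₀ - t₀ % n) * v by ring]
    exact h1.sub (hsub.mul_right _)

theorem exists_sq_eq_of_common_root {a b c u v a' b' c' u' v' t n : ℤ} (hn : 0 < n)
    (h : b ^ 2 - Δ = a * c) (h' : b' ^ 2 - Δ = a' * c') (haa : a * a' < -Δ) (hΔ : Δ < 0)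
    (hf : n = a * u ^ 2 + 2 * b * u * v + c * v ^ 2)
    (hf' : n = a' * u' ^ 2 + 2 * b' * u' * v' + c' * v' ^ 2)
    (ht : n ∣ t ^ 2 - Δ) (hd : n ∣ v * t + (a * u + b * v)) (hd' : n ∣ v' * t + (a' * u' + b' * v')) :
    (∃ X : ℤ, X ^ 2 = a * a') ∧ v' * (a * u + b * v) = v * (a' * u' + b' * v') := by
  set α := a * u + b * v with hα
  set α' := a' * u' + b' * v' with hα'
  obtain ⟨Y, hY⟩ : n ∣ v' * α - v * α' := by
    rw [show v' * α - v * α' = (v * t + α) * v' - (v' * t + α') * v by ring]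
    exact (hd.mul_right _).sub (hd'.mul_right _)
  obtain ⟨X, hX⟩ : n ∣ α * α' - Δ * (v * v') := by
    rw [show α * α' - Δ * (v * v') =
      (v' * t + α') * α - (v * t + α) * (v' * t) + (t ^ 2 - Δ) * (v * v') by ring]
    exact ((hd'.mul_right _).sub (hd.mul_right _)).add (ht.mul_right _)
  have e1 : α ^ 2 - Δ * v ^ 2 = a * n := by
    rw [hα, hf]
    linear_combination v ^ 2 * h
  have e2 : α' ^ 2 - Δ * v' ^ 2 = a' * n := by
    rw [hα', hf']
    linear_combination v' ^ 2 * h'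
  have e3 : n ^ 2 * (X ^ 2 - Δ * Y ^ 2) = n ^ 2 * (a * a') := by
    have : (α * α' - Δ * (v * v')) ^ 2 - Δ * (v' * α - v * α') ^ 2 = (a * n) * (a' * n) := by
      rw [← e1, ← e2]
      ring
    rw [hX, hY] at this
    linear_combination this
  have e4 := mul_left_cancel₀ (pow_ne_zero 2 hn.ne') e3
  have hY0 : Y = 0 := by
    by_contra hne
    have h0 : 0 < Y ^ 2 := by positivity
    have h1 : 1 ≤ Y ^ 2 := h0
    nlinarith [sq_nonneg X]
  subst hY0
  refine ⟨⟨X, by linear_combination e4⟩, ?_⟩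
  linear_combination hY

theorem eq_of_sq_eq_mul {a a' : ℕ} (ha : a = 1 ∨ a.Prime) (ha' : a' = 1 ∨ a'.Prime)
    (h : ∃ X : ℤ, X ^ 2 = (a : ℤ) * a') : a = a' := by
  obtain ⟨X, hX⟩ := h
  have h1 : X.natAbs ^ 2 = a * a' := by
    zify
    rw [sq_abs, hX]
  generalize X.natAbs = x at h1
  have key : ∀ {p k : ℕ}, p.Prime → x ^ 2 = p * k → p ∣ k := fun {p k} hp hpk => by
    have h2 : p ∣ x := hp.dvd_of_dvd_pow (hpk ▸ dvd_mul_right p k)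
    obtain ⟨y, rfl⟩ := h2
    refine ⟨y ^ 2, ?_⟩
    have : p * k = p * (p * y ^ 2) := by
      rw [← hpk]
      ring
    exact Nat.eq_of_mul_eq_mul_left hp.pos this
  rcases ha with rfl | ha
  · rcases ha' with rfl | ha'
    · rfl
    · have := key ha' (by rw [h1, mul_comm])
      exact absurd (Nat.dvd_one.mp this) ha'.ne_one
  · have := key ha h1
    rcases ha' with rfl | ha'
    · exact absurd (Nat.dvd_one.mp this) ha.ne_one
    · exact (Nat.prime_dvd_prime_iff_eq ha ha').mp this

variable {S : Finset ℕ} {b c : ℕ → ℕ}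

/-- The points `(u, v)` with `u` odd and `v` even where one of the forms of leading coefficient
`a ∈ S` takes a value at most `s ^ 2`. -/
def formPoints (S : Finset ℕ) (b c : ℕ → ℕ) (s : ℕ) : Finset (ℕ × ℕ × ℕ) :=
  {w ∈ S ×ˢ Ioc 0 s ×ˢ Ioc 0 s | Odd w.2.1 ∧ Even w.2.2 ∧
    formValue w.1 (b w.1) (c w.1) w.2.1 w.2.2 ≤ s ^ 2}

theorem card_formPoints_le (hΔ : Δ < 0) (hodd : ∀ a ∈ S, Odd a) (hlt : ∀ a ∈ S, (a : ℤ) ^ 2 < -Δ)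
    (hprime : ∀ a ∈ S, a = 1 ∨ a.Prime) (hbc : ∀ a ∈ S, (b a : ℤ) ^ 2 - Δ = a * c a) (s : ℕ) :
    #(formPoints S b c s) ≤
      ∑ g ∈ Ioc 0 s, ∑ n ∈ Ioc 0 (s ^ 2 / g ^ 2) with Odd n, #(squareRoots Δ n) := by
  have hfact : ∀ w ∈ formPoints S b c s, w.1 ∈ S ∧ ∃ g u v : ℕ, 0 < g ∧ g ≤ s ∧ 0 < u ∧ 0 < v ∧
      u.Coprime v ∧ w.2 = (g * u, g * v) ∧
      Odd (formValue w.1 (b w.1) (c w.1) u v) ∧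
      formValue w.1 (b w.1) (c w.1) u v ≤ s ^ 2 / g ^ 2 ∧
      ∃ t ∈ squareRoots Δ (formValue w.1 (b w.1) (c w.1) u v),
        (formValue w.1 (b w.1) (c w.1) u v : ℤ) ∣ v * t + (w.1 * u + b w.1 * v) := by
    rintro ⟨a, u₀, v₀⟩ hw
    simp only [formPoints, mem_filter, mem_product, mem_Ioc] at hw
    obtain ⟨⟨ha, ⟨hu0, hus⟩, hv0, hvs⟩, huo, hve, hle⟩ := hw
    obtain ⟨g, u, v, hg, hcop, hu, hv⟩ := Nat.exists_coprime' (Nat.gcd_pos_of_pos_left v₀ hu0)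
    rw [mul_comm] at hu hv
    have hgo : Odd g ∧ Odd u := Nat.odd_mul.mp (hu ▸ huo)
    have hve' : Even v := by
      rcases Nat.even_mul.mp (hv ▸ hve) with h | h
      · exact absurd hgo.1 (Nat.not_odd_iff_even.mpr h)
      · exact h
    have hu1 : 0 < u := hgo.2.pos
    have hv1 : 0 < v := Nat.pos_of_mul_pos_left (hv ▸ hv0)
    have hfo := odd_formValue (b := b a) (c := c a) (hodd a ha) hgo.2 hve'
    refine ⟨ha, g, u, v, hg, ?_, hu1, hv1, hcop, ?_, hfo, ?_,
      exists_mem_squareRoots (hbc a ha) hcop hfo.pos⟩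
    · exact (Nat.le_mul_of_pos_right g hu1).trans (hu ▸ hus)
    · rw [hu, hv]
    · rw [hu, hv, formValue_mul] at hle
      rw [Nat.le_div_iff_mul_le (by positivity), mul_comm]
      exact hle
  choose! hS g u v hg hgs hu hv hcop hw hfo hfle t ht hd using hfact
  let φ : ℕ × ℕ × ℕ → (_ : ℕ) × (_ : ℕ) × ℕ := fun w =>
    ⟨g w, formValue w.1 (b w.1) (c w.1) (u w) (v w), t w⟩
  have hcard : ∑ g ∈ Ioc 0 s, ∑ n ∈ Ioc 0 (s ^ 2 / g ^ 2) with Odd n, #(squareRoots Δ n)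
      = #((Ioc 0 s).sigma fun g =>
        ({n ∈ Ioc 0 (s ^ 2 / g ^ 2) | Odd n} : Finset ℕ).sigma fun n => squareRoots Δ n) := by
    simp only [Finset.card_sigma]
  rw [hcard]
  refine Finset.card_le_card_of_injOn φ (fun w hwm => ?_) ?_
  · simp only [φ, Finset.coe_sigma, Set.mem_sigma_iff, mem_coe, mem_Ioc, mem_filter]
    exact ⟨⟨hg w hwm, hgs w hwm⟩, ⟨⟨(hfo w hwm).pos, hfle w hwm⟩, hfo w hwm⟩, ht w hwm⟩
  · intro w hwm w' hwm' heq
    rw [mem_coe] at hwm hwm'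
    simp only [φ, Sigma.mk.injEq, heq_eq_eq] at heq
    obtain ⟨h1, h2, h3⟩ := heq
    have hn := (hfo w hwm).pos
    have hd1 := hd w hwm
    have hd2 := hd w' hwm'
    have ht1 := (mem_squareRoots.mp (ht w hwm)).2
    rw [← h2, ← h3] at hd2
    have hlt1 := hlt _ (hS w hwm)
    have hlt2 := hlt _ (hS w' hwm')
    have key := exists_sq_eq_of_common_root (n := (formValue w.1 (b w.1) (c w.1) (u w) (v w) : ℕ))
      (u := u w) (v := v w) (u' := u w') (v' := v w') (t := t w) (by exact_mod_cast hn)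
      (hbc _ (hS w hwm)) (hbc _ (hS w' hwm')) (by nlinarith [sq_nonneg ((w.1 : ℤ) - w'.1)]) hΔ
      (by unfold formValue; push_cast; ring)
      (by rw [h2]; unfold formValue; push_cast; ring) ht1 hd1 hd2
    have haa := eq_of_sq_eq_mul (hprime _ (hS w hwm)) (hprime _ (hS w' hwm')) key.1
    have hcross : u w * v w' = u w' * v w := by
      have h4 := key.2
      rw [← haa] at h4
      have ha0 : (w.1 : ℤ) ≠ 0 := by
        exact_mod_cast (hodd _ (hS w hwm)).pos.ne'
      have h5 : (w.1 : ℤ) * (u w * v w') = w.1 * (u w' * v w) := by linear_combination h4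
      exact_mod_cast mul_left_cancel₀ ha0 h5
    have huu : u w = u w' := by
      refine Nat.dvd_antisymm ?_ ?_
      · exact (hcop w hwm).dvd_of_dvd_mul_right ⟨v w', hcross.symm⟩
      · exact (hcop w' hwm').dvd_of_dvd_mul_right ⟨v w, hcross⟩
    have hvv : v w = v w' := by
      rw [huu] at hcross
      exact (Nat.eq_of_mul_eq_mul_left (hu w' hwm') hcross).symm
    refine Prod.ext haa ?_
    rw [hw w hwm, hw w' hwm', h1, huu, hvv]

end FormCounting

section LatticeLowerBound

theorem formValue_le {a b c u v : ℕ} (ha : 0 < a) (h : b ^ 2 ≤ a * c) :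
    formValue a b c u v ≤ 2 * (a * u ^ 2 + c * v ^ 2) := by
  unfold formValue
  zify at h ha ⊢
  have h1 : (0 : ℤ) ≤ a * (a * u ^ 2 - 2 * b * u * v + c * v ^ 2) := by
    have : (a : ℤ) * (a * u ^ 2 - 2 * b * u * v + c * v ^ 2)
        = (a * u - b * v) ^ 2 + (a * c - b ^ 2) * v ^ 2 := by ring
    rw [this]
    have := mul_nonneg (sub_nonneg.mpr h) (sq_nonneg (v : ℤ))
    positivity
  have h2 := nonneg_of_mul_nonneg_right h1 ha
  linarith

theorem mul_sq_le_of_lt_floor {a s i : ℕ} (ha : 0 < a) (hi : i < ⌊(s : ℝ) / (4 * √a)⌋₊) :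
    16 * (a * (i + 1) ^ 2) ≤ s ^ 2 := by
  have ha' : (0 : ℝ) < √a := Real.sqrt_pos.mpr (by exact_mod_cast ha)
  have h1 : ((i + 1 : ℕ) : ℝ) ≤ (s : ℝ) / (4 * √a) :=
    (Nat.le_floor_iff (by positivity)).mp hi
  rw [le_div_iff₀ (by positivity)] at h1
  have h2 : (((i + 1 : ℕ) : ℝ) * (4 * √a)) ^ 2 ≤ (s : ℝ) ^ 2 :=
    pow_le_pow_left₀ (by positivity) h1 2
  rw [mul_pow, mul_pow, Real.sq_sqrt (by positivity)] at h2
  have h3 : (16 * (a * (i + 1 : ℕ) ^ 2) : ℝ) ≤ (s : ℝ) ^ 2 := by linarith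
  exact_mod_cast h3

theorem le_floor_div_sqrt {a s : ℕ} (ha : 0 < a) (h : 4 * a ≤ s) :
    (s : ℝ) / (8 * √a) ≤ ⌊(s : ℝ) / (4 * √a)⌋₊ := by
  have ha' : (0 : ℝ) < √a := Real.sqrt_pos.mpr (by exact_mod_cast ha)
  have ha1 : (1 : ℝ) ≤ a := by exact_mod_cast ha
  have h1 : √(a : ℝ) ≤ a := Real.sqrt_le_iff.mpr ⟨by positivity, by nlinarith⟩
  have hs : (4 * a : ℝ) ≤ s := by exact_mod_cast h
  have hx : 1 ≤ (s : ℝ) / (4 * √a) := by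
    rw [le_div_iff₀ (by positivity)]
    linarith
  have h2 : (s : ℝ) / (8 * √a) = (s : ℝ) / (4 * √a) / 2 := by
    rw [div_div]
    ring
  have h3 := Nat.lt_floor_add_one ((s : ℝ) / (4 * √a))
  have h4 : (1 : ℝ) ≤ (⌊(s : ℝ) / (4 * √a)⌋₊ : ℝ) := by
    exact_mod_cast (Nat.one_le_floor_iff _).mpr hx
  rw [h2]
  linarith

variable {Δ : ℤ} {S : Finset ℕ} {b c : ℕ → ℕ}

theorem sum_floor_mul_floor_le_card_formPoints (ha : ∀ a ∈ S, Odd a) (hc : ∀ a ∈ S, 0 < c a)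
    (hbc : ∀ a ∈ S, b a ^ 2 ≤ a * c a) (s : ℕ) :
    ∑ a ∈ S, ⌊(s : ℝ) / (4 * √a)⌋₊ * ⌊(s : ℝ) / (4 * √(c a))⌋₊ ≤ #(formPoints S b c s) := by
  have hcard : ∑ a ∈ S, ⌊(s : ℝ) / (4 * √a)⌋₊ * ⌊(s : ℝ) / (4 * √(c a))⌋₊
      = #(S.sigma fun a =>
        range ⌊(s : ℝ) / (4 * √a)⌋₊ ×ˢ range ⌊(s : ℝ) / (4 * √(c a))⌋₊) := by
    simp only [Finset.card_sigma, Finset.card_product, card_range]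
  rw [hcard]
  refine Finset.card_le_card_of_injOn
    (fun w => (w.1, 2 * w.2.1 + 1, 2 * (w.2.2 + 1))) (fun w hw => ?_) ?_
  · obtain ⟨a, i, j⟩ := w
    simp only [coe_sigma, Set.mem_sigma_iff, mem_coe, mem_product, mem_range] at hw
    obtain ⟨haS, hi, hj⟩ := hw
    have h1 := mul_sq_le_of_lt_floor (ha a haS).pos hi
    have h2 := mul_sq_le_of_lt_floor (hc a haS) hj
    have h3 := formValue_le (u := 2 * i + 1) (v := 2 * (j + 1)) (ha a haS).pos (hbc a haS)
    have h4 : a * (2 * i + 1) ^ 2 ≤ 4 * (a * (i + 1) ^ 2) := by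
      have : (2 * i + 1) ^ 2 ≤ (2 * (i + 1)) ^ 2 := Nat.pow_le_pow_left (by omega) 2
      calc a * (2 * i + 1) ^ 2 ≤ a * (2 * (i + 1)) ^ 2 := Nat.mul_le_mul_left a this
        _ = 4 * (a * (i + 1) ^ 2) := by ring
    have h5 : c a * (2 * (j + 1)) ^ 2 = 4 * (c a * (j + 1) ^ 2) := by ring
    have h6 : (2 * i + 1) ^ 2 ≤ a * (2 * i + 1) ^ 2 := Nat.le_mul_of_pos_left _ (ha a haS).pos
    have h7 : (2 * (j + 1)) ^ 2 ≤ c a * (2 * (j + 1)) ^ 2 := Nat.le_mul_of_pos_left _ (hc a haS)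
    simp only [formPoints, mem_coe, mem_filter, mem_product, mem_Ioc]
    refine ⟨⟨haS, ⟨by omega, ?_⟩, by omega, ?_⟩, odd_two_mul_add_one i, even_two_mul _, by omega⟩
    · exact (Nat.pow_le_pow_iff_left two_ne_zero).mp (by omega)
    · exact (Nat.pow_le_pow_iff_left two_ne_zero).mp (by omega)
  · rintro ⟨a, i, j⟩ _ ⟨a', i', j'⟩ _ h
    simp only [Prod.mk.injEq] at h
    obtain ⟨rfl, h1, h2⟩ := h
    obtain rfl : i = i' := by omega
    obtain rfl : j = j' := by omega
    rfl

theorem card_mul_sq_le {m : ℕ} (ha : ∀ a ∈ S, Odd a) (ham : ∀ a ∈ S, a ≤ m)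
    (hc : ∀ a ∈ S, 0 < c a) (hbc : ∀ a ∈ S, b a ^ 2 ≤ a * c a) (hac : ∀ a ∈ S, a * c a ≤ 2 * m)
    {s : ℕ} (hs : 8 * m ≤ s) :
    #S * (s : ℝ) ^ 2 ≤ 100 * √m * #(formPoints S b c s) := by
  have h1 : (∑ a ∈ S, (⌊(s : ℝ) / (4 * √a)⌋₊ : ℝ) * (⌊(s : ℝ) / (4 * √(c a))⌋₊ : ℝ))
      ≤ #(formPoints S b c s) := by
    exact_mod_cast sum_floor_mul_floor_le_card_formPoints ha hc hbc s
  have h2 : ∀ a ∈ S, (s : ℝ) ^ 2 ≤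
      100 * √m * ((⌊(s : ℝ) / (4 * √a)⌋₊ : ℝ) * (⌊(s : ℝ) / (4 * √(c a))⌋₊ : ℝ)) := by
    intro a haS
    have ha0 := (ha a haS).pos
    have hc0 := hc a haS
    have hcm : c a ≤ 2 * m := (Nat.le_mul_of_pos_left _ ha0).trans (hac a haS)
    have h3 := le_floor_div_sqrt ha0 (s := s) (by have := ham a haS; omega)
    have h4 := le_floor_div_sqrt hc0 (s := s) (by omega)
    have h5 : √(a : ℝ) * √(c a : ℝ) ≤ 3 / 2 * √m := by
      rw [← Real.sqrt_mul (by positivity)]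
      have h6 : ((a : ℝ) * c a) ≤ 2 * m := by exact_mod_cast hac a haS
      rw [Real.sqrt_le_left (by positivity), mul_pow, Real.sq_sqrt (by positivity)]
      have : (0 : ℝ) ≤ m := by positivity
      linarith
    have ha' : (0 : ℝ) < √a := Real.sqrt_pos.mpr (by exact_mod_cast ha0)
    have hc' : (0 : ℝ) < √(c a) := Real.sqrt_pos.mpr (by exact_mod_cast hc0)
    calc (s : ℝ) ^ 2 = 64 * (√a * √(c a)) * ((s : ℝ) / (8 * √a) * ((s : ℝ) / (8 * √(c a)))) := by
          field_simp
          norm_num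
      _ ≤ 100 * √m * ((s : ℝ) / (8 * √a) * ((s : ℝ) / (8 * √(c a)))) := by
          refine mul_le_mul_of_nonneg_right ?_ (by positivity)
          have : 0 ≤ √(m : ℝ) := Real.sqrt_nonneg _
          linarith
      _ ≤ _ := by gcongr
  calc #S * (s : ℝ) ^ 2 = ∑ a ∈ S, (s : ℝ) ^ 2 := by rw [Finset.sum_const, nsmul_eq_mul]
    _ ≤ ∑ a ∈ S, 100 * √m *
        ((⌊(s : ℝ) / (4 * √a)⌋₊ : ℝ) * (⌊(s : ℝ) / (4 * √(c a))⌋₊ : ℝ)) := Finset.sum_le_sum h2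
    _ = 100 * √m * ∑ a ∈ S, ((⌊(s : ℝ) / (4 * √a)⌋₊ : ℝ) * (⌊(s : ℝ) / (4 * √(c a))⌋₊ : ℝ)) :=
        (Finset.mul_sum _ _ _).symm
    _ ≤ _ := mul_le_mul_of_nonneg_left h1 (by positivity)

theorem sum_card_squareRoots_le (hsq : ∀ p : ℕ, p.Prime → p ≠ 2 → ¬ (p : ℤ) ^ 2 ∣ Δ) (y : ℕ) :
    ((∑ n ∈ Ioc 0 y with Odd n, #(squareRoots Δ n) : ℕ) : ℝ) ≤ divisorSummatory (oddSymbol Δ) y := by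
  push_cast
  refine (Finset.sum_le_sum fun n hn => card_squareRoots_le hsq (mem_filter.mp hn).2).trans ?_
  exact Finset.sum_le_sum_of_subset_of_nonneg (Finset.filter_subset _ _)
    fun n _ _ => divisorSum_oddSymbol_nonneg Δ n

theorem sum_Ioc_inv_sq_le_two (s : ℕ) : ∑ g ∈ Ioc 0 s, ((g : ℝ) ^ 2)⁻¹ ≤ 2 := by
  have h := sum_Ioo_inv_sq_le (α := ℝ) 0 (s + 1)
  have e : Ioo 0 (s + 1) = Ioc 0 s := by
    ext x
    simp only [mem_Ioo, mem_Ioc]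
    omega
  rw [e] at h
  norm_num at h
  exact h

variable {ℓ : ℝ}

theorem limit_nonneg (hΔ : Δ < 0)
    (hℓ : Tendsto (fun N : ℕ => ∑ d ∈ range N, oddSymbol Δ d * (d : ℝ)⁻¹) atTop (𝓝 ℓ)) : 0 ≤ ℓ := by
  refine ge_of_tendsto (tendsto_lValue (abs_oddSymbol_le_one Δ) (abs_sum_oddSymbol_le hΔ) hℓ) ?_
  filter_upwards [eventually_ge_atTop 1] with J hJ
  exact lValue_nonneg (abs_oddSymbol_le_one Δ) hJ

theorem card_formPoints_le_limit (hΔ : Δ < 0)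
    (hsq : ∀ p : ℕ, p.Prime → p ≠ 2 → ¬ (p : ℤ) ^ 2 ∣ Δ)
    (hℓ : Tendsto (fun N : ℕ => ∑ d ∈ range N, oddSymbol Δ d * (d : ℝ)⁻¹) atTop (𝓝 ℓ))
    (hodd : ∀ a ∈ S, Odd a) (hlt : ∀ a ∈ S, (a : ℤ) ^ 2 < -Δ)
    (hprime : ∀ a ∈ S, a = 1 ∨ a.Prime) (hbc : ∀ a ∈ S, (b a : ℤ) ^ 2 - Δ = a * c a)
    (s : ℕ) {D : ℕ} (hD : 1 ≤ D) :
    (#(formPoints S b c s) : ℝ) ≤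
      2 * (s : ℝ) ^ 2 * (ℓ + 4 * (4 * (Δ.natAbs : ℝ)) / D) + s * D := by
  have h0 := limit_nonneg hΔ hℓ
  have h1 : (#(formPoints S b c s) : ℝ) ≤
      ∑ g ∈ Ioc 0 s, divisorSummatory (oddSymbol Δ) (s ^ 2 / g ^ 2) := by
    refine (Nat.cast_le.mpr (card_formPoints_le hΔ hodd hlt hprime hbc s)).trans ?_
    rw [Nat.cast_sum]
    exact Finset.sum_le_sum fun g _ => sum_card_squareRoots_le hsq _
  set E := ℓ + 4 * (4 * (Δ.natAbs : ℝ)) / D with hE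
  have hE0 : 0 ≤ E := by positivity
  calc (#(formPoints S b c s) : ℝ)
      ≤ ∑ g ∈ Ioc 0 s, divisorSummatory (oddSymbol Δ) (s ^ 2 / g ^ 2) := h1
    _ ≤ ∑ g ∈ Ioc 0 s, ((s : ℝ) ^ 2 * E * ((g : ℝ) ^ 2)⁻¹ + D) := by
        refine Finset.sum_le_sum fun g _ => ?_
        refine (divisorSummatory_le (abs_oddSymbol_le_one Δ) (abs_sum_oddSymbol_le hΔ) hℓ _
          hD).trans ?_
        rw [← hE]
        have h2 : ((s ^ 2 / g ^ 2 : ℕ) : ℝ) ≤ (s : ℝ) ^ 2 / (g : ℝ) ^ 2 := by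
          exact_mod_cast Nat.cast_div_le (α := ℝ) (m := s ^ 2) (n := g ^ 2)
        have h3 := mul_le_mul_of_nonneg_right h2 hE0
        rw [div_eq_mul_inv] at h3
        linarith
    _ = (s : ℝ) ^ 2 * E * ∑ g ∈ Ioc 0 s, ((g : ℝ) ^ 2)⁻¹ + s * D := by
        rw [Finset.sum_add_distrib, ← Finset.mul_sum, Finset.sum_const, Nat.card_Ioc, nsmul_eq_mul,
          Nat.sub_zero]
    _ ≤ (s : ℝ) ^ 2 * E * 2 + s * D := by
        gcongr
        exact sum_Ioc_inv_sq_le_two s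
    _ = _ := by ring

theorem card_le_sqrt_mul_limit (hΔ : Δ < 0)
    (hsq : ∀ p : ℕ, p.Prime → p ≠ 2 → ¬ (p : ℤ) ^ 2 ∣ Δ)
    (hℓ : Tendsto (fun N : ℕ => ∑ d ∈ range N, oddSymbol Δ d * (d : ℝ)⁻¹) atTop (𝓝 ℓ))
    (hodd : ∀ a ∈ S, Odd a) (hlt : ∀ a ∈ S, (a : ℤ) ^ 2 < -Δ)
    (hprime : ∀ a ∈ S, a = 1 ∨ a.Prime) (hbc : ∀ a ∈ S, (b a : ℤ) ^ 2 - Δ = a * c a)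
    (hb : ∀ a ∈ S, b a < a) :
    (#S : ℝ) ≤ 200 * √(Δ.natAbs : ℝ) * ℓ := by
  set m := Δ.natAbs with hm
  have hmΔ : -Δ = (m : ℤ) := by omega
  have hm0 : 0 < m := by omega
  have ham : ∀ a ∈ S, a ≤ m := fun a ha => by
    have := hlt a ha
    rw [hmΔ] at this
    have h2 : a ^ 2 < m := by exact_mod_cast this
    nlinarith [(hodd a ha).pos]
  have hbc' : ∀ a ∈ S, b a ^ 2 + m = a * c a := fun a ha => by
    have := hbc a ha
    rw [sub_eq_add_neg, hmΔ] at this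
    exact_mod_cast this
  have hbc2 : ∀ a ∈ S, b a ^ 2 ≤ a * c a := fun a ha => by
    have := hbc' a ha
    omega
  have hc : ∀ a ∈ S, 0 < c a := fun a ha => by
    have := hbc' a ha
    by_contra! h
    rw [Nat.le_zero.mp h, mul_zero] at this
    omega
  have hac : ∀ a ∈ S, a * c a ≤ 2 * m := fun a ha => by
    have h1 := hlt a ha
    rw [hmΔ] at h1
    have h2 : a ^ 2 < m := by exact_mod_cast h1
    have h3 := Nat.pow_le_pow_left (hb a ha).le 2
    have := hbc' a ha
    omega
  have hlim : Tendsto (fun k : ℕ => 100 * √(m : ℝ) * (2 * ℓ + (32 * m + 1) * (1 / (k : ℝ)))) atTop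
      (𝓝 (100 * √(m : ℝ) * (2 * ℓ + (32 * m + 1) * 0))) :=
    ((tendsto_one_div_atTop_nhds_zero_nat.const_mul _).const_add _).const_mul _
  have hfin : (#S : ℝ) ≤ 100 * √(m : ℝ) * (2 * ℓ + (32 * m + 1) * 0) := by
    refine ge_of_tendsto hlim ?_
    filter_upwards [eventually_ge_atTop 1] with k hk
    have hk0 : (0 : ℝ) < k := by exact_mod_cast hk
    have hk1 : (1 : ℝ) ≤ k := by exact_mod_cast hk
    have hm1 : (1 : ℝ) ≤ m := by exact_mod_cast hm0
    have hs : 8 * m ≤ 8 * m * k ^ 2 := Nat.le_mul_of_pos_right _ (by positivity)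
    have h1 := card_mul_sq_le hodd ham hc hbc2 hac hs
    have h2 := card_formPoints_le_limit hΔ hsq hℓ hodd hlt hprime hbc (8 * m * k ^ 2) hk
    rw [← hm] at h2
    have hs0 : (0 : ℝ) < ((8 * m * k ^ 2 : ℕ) : ℝ) := by positivity
    have hsk : (k : ℝ) ^ 2 ≤ ((8 * m * k ^ 2 : ℕ) : ℝ) := by
      push_cast
      nlinarith [sq_nonneg (k : ℝ)]
    generalize ((8 * m * k ^ 2 : ℕ) : ℝ) = s at hs0 hsk h1 h2
    generalize (#(formPoints S b c (8 * m * k ^ 2)) : ℝ) = w at h1 h2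
    have h3 : s * k ≤ s ^ 2 * (1 / k) := by
      rw [mul_one_div, le_div_iff₀ hk0]
      nlinarith
    have h4 : w ≤ s ^ 2 * (2 * ℓ + (32 * m + 1) * (1 / (k : ℝ))) := by
      refine h2.trans ?_
      have : 2 * s ^ 2 * (ℓ + 4 * (4 * (m : ℝ)) / k) = s ^ 2 * (2 * ℓ + 32 * m * (1 / (k : ℝ))) := by
        ring
      rw [this]
      linarith
    have h5 : (#S : ℝ) * s ^ 2 ≤
        100 * √(m : ℝ) * (2 * ℓ + (32 * m + 1) * (1 / (k : ℝ))) * s ^ 2 := by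
      refine h1.trans ((mul_le_mul_of_nonneg_left h4 (by positivity)).trans_eq ?_)
      ring
    exact le_of_mul_le_mul_right h5 (by positivity)
  linarith

/-- The integer `1` together with the odd primes `p` with `p ^ 2 < |Δ|` that split. -/
def smallSplit (Δ : ℤ) : Finset ℕ :=
  {a ∈ range Δ.natAbs | Odd a ∧ a ^ 2 < Δ.natAbs ∧ (a = 1 ∨ a.Prime ∧ jacobiSym Δ a = 1)}

theorem exists_sqrt_of_mem_smallSplit (hΔ : Δ < 0) {a : ℕ} (ha : a ∈ smallSplit Δ) :
    ∃ b c : ℕ, b < a ∧ (b : ℤ) ^ 2 - Δ = a * c := by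
  simp only [smallSplit, mem_filter, mem_range] at ha
  obtain ⟨_, ho, _, h⟩ := ha
  suffices h : ∃ b : ℕ, b < a ∧ (a : ℤ) ∣ (b : ℤ) ^ 2 - Δ by
    obtain ⟨b, hb, k, hk⟩ := h
    refine ⟨b, k.toNat, hb, ?_⟩
    rw [hk, Int.toNat_of_nonneg]
    have : (0 : ℤ) < a * k := by nlinarith [sq_nonneg (b : ℤ)]
    exact (pos_of_mul_pos_right this (by positivity)).le
  rcases h with rfl | ⟨hp, hj⟩
  · exact ⟨0, by norm_num, by simp⟩
  · have : Fact a.Prime := ⟨hp⟩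
    rw [← jacobiSym.legendreSym.to_jacobiSym] at hj
    have h0 : (Δ : ZMod a) ≠ 0 := fun h => by
      rw [(legendreSym.eq_zero_iff a Δ).mpr h] at hj
      norm_num at hj
    obtain ⟨y, hy⟩ := (legendreSym.eq_one_iff a h0).mp hj
    refine ⟨y.val, ZMod.val_lt y, ?_⟩
    rw [← ZMod.intCast_zmod_eq_zero_iff_dvd]
    push_cast
    rw [ZMod.natCast_zmod_val, hy]
    ring

theorem card_smallSplit_le (hΔ : Δ < 0)
    (hsq : ∀ p : ℕ, p.Prime → p ≠ 2 → ¬ (p : ℤ) ^ 2 ∣ Δ)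
    (hℓ : Tendsto (fun N : ℕ => ∑ d ∈ range N, oddSymbol Δ d * (d : ℝ)⁻¹) atTop (𝓝 ℓ)) :
    (#(smallSplit Δ) : ℝ) ≤ 200 * √(Δ.natAbs : ℝ) * ℓ := by
  have h := fun a (ha : a ∈ smallSplit Δ) => exists_sqrt_of_mem_smallSplit hΔ ha
  choose! b c hb hbc using h
  refine card_le_sqrt_mul_limit hΔ hsq hℓ (fun a ha => ?_) (fun a ha => ?_) (fun a ha => ?_) hbc hb
  all_goals
    simp only [smallSplit, mem_filter, mem_range] at ha
  · exact ha.2.1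
  · have h1 : -Δ = (Δ.natAbs : ℤ) := by omega
    rw [h1]
    exact_mod_cast ha.2.2.1
  · exact ha.2.2.2.imp id And.left

end LatticeLowerBound

section TruncatedProducts

variable {χ : ℕ →*₀ ℝ}

theorem truncProd_mul_prod_Ico (χ : ℕ →*₀ ℝ) {N M : ℕ} (hNM : N ≤ M) :
    truncProd χ N * ∏ p ∈ Ico N M with p.Prime, (1 - χ p / p) = truncProd χ M := by
  have h : ∀ K : ℕ, truncProd χ K = ∏ p ∈ range K, if p.Prime then 1 - χ p / p else 1 := fun K => by
    rw [← Finset.prod_filter]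
    rfl
  rw [h, h, Finset.prod_filter, Finset.prod_range_mul_prod_Ico _ hNM]

theorem inv_truncProd_le_mul_exp (hχ : ∀ n, |χ n| ≤ 1) {a b N M : ℕ} (hN : 2 ^ a ≤ N)
    (hNM : N ≤ M) (hM : M ≤ 2 ^ b) :
    (truncProd χ M)⁻¹ ≤ (truncProd χ N)⁻¹ * Real.exp (2 * ∑ j ∈ Ico a b, 4 / (j : ℝ)) := by
  have hab : a ≤ b := (Nat.pow_le_pow_iff_right (by norm_num : 1 < 2)).mp (hN.trans (hNM.trans hM))
  rw [← truncProd_mul_prod_Ico χ hNM, mul_inv]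
  refine mul_le_mul_of_nonneg_left ?_ (inv_nonneg.mpr (truncProd_pos hχ N).le)
  have hpr : ∀ p ∈ ({p ∈ Ico N M | p.Prime} : Finset ℕ), p.Prime := fun p hp =>
    (mem_filter.mp hp).2
  rw [← Finset.prod_inv_distrib]
  calc ∏ p ∈ Ico N M with p.Prime, (1 - χ p / p)⁻¹
      ≤ ∏ p ∈ Ico N M with p.Prime, Real.exp (2 * (p : ℝ)⁻¹) := by
        refine Finset.prod_le_prod (fun p hp => ?_) fun p hp => ?_
        · have := half_le_one_sub (hχ p) (by positivity) (inv_prime_le_half (hpr p hp))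
          rw [div_eq_mul_inv]
          exact inv_nonneg.mpr (by linarith)
        · have := half_le_one_sub (hχ p) (by positivity) (inv_prime_le_half (hpr p hp))
          rw [div_eq_mul_inv, ← one_mul (1 - χ p * (p : ℝ)⁻¹)⁻¹]
          refine ratio_le_exp this ?_
          rw [sub_sub_cancel, abs_mul, abs_of_nonneg (by positivity : (0 : ℝ) ≤ (p : ℝ)⁻¹)]
          exact mul_le_of_le_one_left (by positivity) (hχ p)
    _ = Real.exp (2 * ∑ p ∈ Ico N M with p.Prime, (p : ℝ)⁻¹) := by
        rw [← Real.exp_sum, Finset.mul_sum]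
    _ ≤ _ := by
        rw [Real.exp_le_exp]
        refine mul_le_mul_of_nonneg_left ?_ (by norm_num)
        have h := sum_primes_weight_le (fun _ => 1) (fun _ => zero_le_one) hab
        simp only [one_mul] at h
        refine le_trans ?_ h
        refine Finset.sum_le_sum_of_subset_of_nonneg ?_ fun p _ _ => by positivity
        exact Finset.filter_subset_filter _ (Finset.Ico_subset_Ico hN hM)

theorem prod_inv_one_sub_inv_le (T : Finset ℕ) (hT : ∀ p ∈ T, 2 ≤ p) :
    ∏ p ∈ T, (1 - (p : ℝ)⁻¹)⁻¹ ≤ 1 + #T := by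
  induction T using Finset.induction_on_max with
  | empty => simp
  | insert a s hs ih =>
    have has : a ∉ s := fun h => lt_irrefl a (hs a h)
    have ha2 := hT a (Finset.mem_insert_self a s)
    have hcard : #s + 2 ≤ a := by
      have h1 : s ⊆ Ico 2 a := fun p hp =>
        mem_Ico.mpr ⟨hT p (Finset.mem_insert_of_mem hp), hs p hp⟩
      have h2 := Finset.card_le_card h1
      rw [Nat.card_Ico] at h2
      omega
    rw [Finset.prod_insert has, Finset.card_insert_of_notMem has]
    have ih' := ih fun p hp => hT p (Finset.mem_insert_of_mem hp)
    have hc : ((#s : ℝ) + 2) ≤ a := by exact_mod_cast hcard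
    have h0 : (0 : ℝ) ≤ #s := by positivity
    have h3 : (1 - (a : ℝ)⁻¹)⁻¹ = a / (a - 1) := by
      have h1 : (a : ℝ) ≠ 0 := by linarith
      have h2 : (a : ℝ) - 1 ≠ 0 := by linarith
      field_simp
    rw [h3]
    have h4 : (0 : ℝ) < a - 1 := by linarith
    calc (a : ℝ) / (a - 1) * ∏ p ∈ s, (1 - (p : ℝ)⁻¹)⁻¹ ≤ a / (a - 1) * (1 + #s) :=
          mul_le_mul_of_nonneg_left ih' (div_nonneg (by linarith) h4.le)
      _ ≤ 1 + ((#s + 1 : ℕ) : ℝ) := by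
          push_cast
          rw [div_mul_eq_mul_div, div_le_iff₀ h4]
          linarith

variable {Δ : ℤ} {ℓ : ℝ}

theorem inv_truncProd_le_card_smallSplit (hm : 1 < Δ.natAbs) {N : ℕ}
    (hN : ∀ p : ℕ, p.Prime → p < N → p ^ 2 < Δ.natAbs) :
    (truncProd (oddSymbol Δ) N)⁻¹ ≤ #(smallSplit Δ) := by
  set T : Finset ℕ := {p ∈ N.primesBelow | oddSymbol Δ p = 1} with hT
  have hsub : insert 1 T ⊆ smallSplit Δ := by
    intro p hp
    rw [Finset.mem_insert] at hp
    simp only [smallSplit, mem_filter, mem_range]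
    rcases hp with rfl | hp
    · exact ⟨hm, odd_one, by simpa using hm, Or.inl rfl⟩
    · rw [hT, mem_filter, Nat.mem_primesBelow] at hp
      obtain ⟨⟨hpN, hpp⟩, h1⟩ := hp
      have hsq := hN p hpp hpN
      have hodd : Odd p := by
        by_contra h
        rw [oddSymbol_of_not_odd h] at h1
        norm_num at h1
      rw [oddSymbol_of_odd hodd] at h1
      exact ⟨lt_of_le_of_lt (Nat.le_self_pow two_ne_zero p) hsq, hodd, hsq,
        Or.inr ⟨hpp, by exact_mod_cast h1⟩⟩
  have hcard : #T + 1 ≤ #(smallSplit Δ) := by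
    rw [← Finset.card_insert_of_notMem (a := 1)]
    · exact Finset.card_le_card hsub
    · simp [hT, Nat.mem_primesBelow, Nat.not_prime_one]
  have h1 := prod_inv_one_sub_inv_le T fun p hp =>
    (Nat.prime_of_mem_primesBelow (mem_filter.mp hp).1).two_le
  have h2 : (truncProd (oddSymbol Δ) N)⁻¹ ≤ ∏ p ∈ T, (1 - (p : ℝ)⁻¹)⁻¹ := by
    rw [truncProd, ← Finset.prod_inv_distrib, hT, Finset.prod_filter]
    refine Finset.prod_le_prod (fun p hp => ?_) fun p hp => ?_
    · have := half_le_one_sub (abs_oddSymbol_le_one Δ p) (by positivity)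
        (inv_prime_le_half (Nat.prime_of_mem_primesBelow hp))
      rw [div_eq_mul_inv]
      exact inv_nonneg.mpr (by linarith)
    · rcases oddSymbol_trichotomy Δ p with h | h | h
      · simp [h]
      · simp [h]
      · rw [h, if_neg (by norm_num)]
        refine inv_le_one_of_one_le₀ ?_
        rw [neg_div, sub_neg_eq_add]
        have : (0 : ℝ) ≤ 1 / p := by positivity
        linarith
  have h3 : ((#T : ℝ) + 1) ≤ #(smallSplit Δ) := by exact_mod_cast hcard
  linarith

theorem sum_four_div_le {a b : ℕ} (ha : 1 ≤ a) (hb : b ≤ 14 * a) :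
    ∑ j ∈ Ico a b, 4 / (j : ℝ) ≤ 56 := by
  have ha' : (0 : ℝ) < a := by exact_mod_cast ha
  calc ∑ j ∈ Ico a b, 4 / (j : ℝ) ≤ ∑ j ∈ Ico a b, 4 / (a : ℝ) := by
        refine Finset.sum_le_sum fun j hj => ?_
        have : (a : ℝ) ≤ j := by exact_mod_cast (mem_Ico.mp hj).1
        gcongr
    _ = ((b - a : ℕ) : ℝ) * (4 / a) := by rw [Finset.sum_const, Nat.card_Ico, nsmul_eq_mul]
    _ ≤ (14 * a) * (4 / a) := by
        refine mul_le_mul_of_nonneg_right ?_ (by positivity)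
        exact_mod_cast (Nat.sub_le b a).trans hb
    _ = 56 := by
        field_simp
        norm_num

theorem inv_truncProd_le_of_le (hm : 1 < Δ.natAbs) {X : ℕ}
    (hX : X ≤ 2 ^ (2 * Nat.log 2 Δ.natAbs + 8)) :
    (truncProd (oddSymbol Δ) X)⁻¹ ≤ #(smallSplit Δ) * Real.exp 112 := by
  set l := Nat.log 2 Δ.natAbs with hl
  have hl2 : 2 ^ l ≤ Δ.natAbs := Nat.pow_log_le_self 2 (by omega)
  have hsmall : ∀ p : ℕ, p.Prime → p < 2 ^ max (l / 2) 1 → p ^ 2 < Δ.natAbs := by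
    intro p hp hlt
    rcases le_total (l / 2) 1 with h | h
    · rw [max_eq_right h] at hlt
      have := hp.two_le
      omega
    · rw [max_eq_left h] at hlt
      calc p ^ 2 < (2 ^ (l / 2)) ^ 2 := Nat.pow_lt_pow_left hlt two_ne_zero
        _ = 2 ^ (l / 2 * 2) := (pow_mul 2 _ _).symm
        _ ≤ 2 ^ l := Nat.pow_le_pow_right (by norm_num) (Nat.div_mul_le_self l 2)
        _ ≤ Δ.natAbs := hl2
  have h1 : (1 : ℝ) ≤ Real.exp 112 := Real.one_le_exp (by norm_num)
  have hk : (0 : ℝ) ≤ #(smallSplit Δ) := by positivity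
  rcases le_total X (2 ^ max (l / 2) 1) with h | h
  · refine (inv_truncProd_le_card_smallSplit hm fun p hp hpX => hsmall p hp (by omega)).trans ?_
    exact le_mul_of_one_le_right hk h1
  · refine (inv_truncProd_le_mul_exp (abs_oddSymbol_le_one Δ) le_rfl h hX).trans ?_
    refine mul_le_mul (inv_truncProd_le_card_smallSplit hm hsmall) ?_ (Real.exp_pos _).le hk
    rw [Real.exp_le_exp]
    have := sum_four_div_le (a := max (l / 2) 1) (b := 2 * l + 8) (by omega) (by omega)
    linarith

theorem divisorSummatory_le_mul (hΔ : Δ < 0)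
    (hℓ : Tendsto (fun N : ℕ => ∑ d ∈ range N, oddSymbol Δ d * (d : ℝ)⁻¹) atTop (𝓝 ℓ))
    {y : ℕ} (hy : 16 * Δ.natAbs ^ 2 ≤ y) :
    divisorSummatory (oddSymbol Δ) y ≤ (ℓ + 3 / √(Δ.natAbs : ℝ)) * y := by
  have hm0 : 0 < Δ.natAbs := by omega
  generalize hm : Δ.natAbs = m at hm0 hy ⊢
  have hm1 : (1 : ℝ) ≤ m := by exact_mod_cast hm0
  set r := √(m : ℝ) with hr
  have hr1 : 1 ≤ r := Real.one_le_sqrt.mpr hm1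
  have hr2 : r ^ 2 = m := Real.sq_sqrt (by positivity)
  have hr0 : 0 < r := by linarith
  have hy' : 16 * (r ^ 2) ^ 2 ≤ y := by
    rw [hr2]
    exact_mod_cast hy
  have hy0 : (0 : ℝ) < y := by
    have : 0 < 16 * (r ^ 2) ^ 2 := by positivity
    linarith
  have hD : 1 ≤ ⌈(y : ℝ) / r⌉₊ := Nat.one_le_ceil_iff.mpr (by positivity)
  refine (divisorSummatory_le (abs_oddSymbol_le_one Δ) (abs_sum_oddSymbol_le hΔ) hℓ y hD).trans ?_
  rw [hm, ← hr2]
  have hD1 : (y : ℝ) / r ≤ ⌈(y : ℝ) / r⌉₊ := Nat.le_ceil _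
  have hD2 : (⌈(y : ℝ) / r⌉₊ : ℝ) < y / r + 1 := Nat.ceil_lt_add_one (by positivity)
  have hx : 16 * r ^ 3 ≤ y / r := by
    rw [le_div_iff₀ hr0]
    linarith
  have h3 : (1 : ℝ) ≤ y / r := by
    have : 1 ≤ r ^ 3 := one_le_pow₀ hr1
    linarith
  have h4 : 4 * (4 * r ^ 2) / (⌈(y : ℝ) / r⌉₊ : ℝ) ≤ 4 * (4 * r ^ 2) / (y / r) := by
    gcongr
  have h5 : (y : ℝ) * (4 * (4 * r ^ 2) / (y / r)) = 16 * r ^ 3 := by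
    field_simp
    ring
  have h6 := mul_le_mul_of_nonneg_left h4 hy0.le
  have h7 : (ℓ + 3 / r) * y = y * ℓ + 3 * (y / r) := by ring
  rw [h7, mul_add]
  linarith

/-- An absolute constant in the upper bound for truncated Euler products. -/
noncomputable def eulerConst : ℝ := Real.exp 40 * (32 * (200 * Real.exp 144 + 601))

theorem eulerConst_pos : 0 < eulerConst := by
  unfold eulerConst
  positivity

theorem inv_truncProd_le (hΔ : Δ < 0) (hm : 1 < Δ.natAbs)
    (hcard : (#(smallSplit Δ) : ℝ) ≤ 200 * √(Δ.natAbs : ℝ) * ℓ)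
    (hpos : 1 ≤ 200 * √(Δ.natAbs : ℝ) * ℓ)
    (hℓ : Tendsto (fun N : ℕ => ∑ d ∈ range N, oddSymbol Δ d * (d : ℝ)⁻¹) atTop (𝓝 ℓ)) (X : ℕ) :
    (truncProd (oddSymbol Δ) X)⁻¹ ≤ eulerConst * (√(Δ.natAbs : ℝ) * ℓ) := by
  have hχ := abs_oddSymbol_le_one Δ
  have hsmall : ∀ Y : ℕ, Y ≤ 2 ^ (2 * Nat.log 2 Δ.natAbs + 8) → (truncProd (oddSymbol Δ) Y)⁻¹ ≤
      200 * √(Δ.natAbs : ℝ) * ℓ * Real.exp 112 := fun Y hY =>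
    (inv_truncProd_le_of_le hm hY).trans
      (mul_le_mul_of_nonneg_right hcard (Real.exp_pos _).le)
  have hJ₀pow : 16 * Δ.natAbs ^ 2 ≤ 2 ^ (2 * Nat.log 2 Δ.natAbs + 8) := by
    have h1 : Δ.natAbs < 2 ^ (Nat.log 2 Δ.natAbs + 1) := Nat.lt_pow_succ_log_self (by norm_num) _
    calc 16 * Δ.natAbs ^ 2 ≤ 16 * (2 ^ (Nat.log 2 Δ.natAbs + 1)) ^ 2 := by gcongr
      _ = 2 ^ (2 * Nat.log 2 Δ.natAbs + 6) := by ring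
      _ ≤ _ := Nat.pow_le_pow_right (by norm_num) (by omega)
  have hJ₀ : 1 ≤ 2 * Nat.log 2 Δ.natAbs + 8 := by omega
  generalize 2 * Nat.log 2 Δ.natAbs + 8 = J₀ at hsmall hJ₀pow hJ₀
  have hr1 : 1 ≤ √(Δ.natAbs : ℝ) := Real.one_le_sqrt.mpr (by exact_mod_cast hm.le)
  have hsum : ∀ y, 2 ^ J₀ ≤ y → divisorSummatory (oddSymbol Δ) y
      ≤ (ℓ + 3 / √(Δ.natAbs : ℝ)) * y := fun y hy =>
    divisorSummatory_le_mul hΔ hℓ (hJ₀pow.trans hy)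
  set r := √(Δ.natAbs : ℝ) with hr
  have hr0 : 0 < r := by linarith
  have hℓ0 : 0 < ℓ := by
    by_contra! h
    nlinarith
  have hB : ℓ + 3 / r ≤ 601 * (r * ℓ) := by
    have h1 : 3 / r ≤ 600 * ℓ := by
      rw [div_le_iff₀ hr0]
      linarith
    nlinarith
  have hrl : 0 < r * ℓ := by positivity
  rcases le_total X (2 ^ J₀) with hX | hX
  · refine (hsmall X hX).trans ?_
    have h1 : Real.exp 112 ≤ Real.exp 144 := Real.exp_le_exp.mpr (by norm_num)
    have h2 : 1 ≤ Real.exp 40 := Real.one_le_exp (by norm_num)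
    have h3 : 200 * Real.exp 112 ≤ eulerConst := by
      unfold eulerConst
      have := Real.exp_pos 144
      nlinarith
    calc 200 * r * ℓ * Real.exp 112 = 200 * Real.exp 112 * (r * ℓ) := by ring
      _ ≤ _ := mul_le_mul_of_nonneg_right h3 hrl.le
  · have hX0 : X ≠ 0 := by
      have : 0 < 2 ^ J₀ := by positivity
      omega
    have hJ : J₀ ≤ Nat.log 2 X := Nat.le_log_of_pow_le (by norm_num) hX
    have hle : 2 ^ Nat.log 2 X ≤ X := Nat.pow_log_le_self 2 hX0
    have hlt : X < 2 ^ (Nat.log 2 X + 1) := Nat.lt_pow_succ_log_self (by norm_num) X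
    generalize Nat.log 2 X = J at hJ hle hlt
    have hJ1 : 1 ≤ J := hJ₀.trans hJ
    have h1 := inv_truncProd_le_mul_exp hχ le_rfl hle hlt.le
    have h2 : (truncProd (oddSymbol Δ) (2 ^ J))⁻¹ ≤ Real.exp 32 * lValue (oddSymbol Δ) J := by
      rw [inv_le_iff_one_le_mul₀ (truncProd_pos hχ _)]
      have := one_le_truncProd_mul_lValue hχ hJ1
      linarith
    have h3 : lValue (oddSymbol Δ) J₀ ≤ 200 * Real.exp 144 * (r * ℓ) := by
      have h4 := truncProd_mul_lValue_le hχ hJ₀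
      rw [mul_comm, ← le_div_iff₀ (truncProd_pos hχ _), div_eq_mul_inv] at h4
      refine h4.trans ((mul_le_mul_of_nonneg_left (hsmall _ le_rfl) (Real.exp_pos _).le).trans_eq ?_)
      rw [show (144 : ℝ) = 32 + 112 by norm_num, Real.exp_add]
      ring
    have h5 := lValue_le_of_summatory_le hχ (divisorSum_oddSymbol_nonneg Δ)
      (by positivity) hJ₀ hJ hsum
    have h6 : 2 * ∑ j ∈ Ico J (J + 1), 4 / (j : ℝ) ≤ 8 := by
      rw [Nat.Ico_succ_singleton, Finset.sum_singleton]
      have : (4 : ℝ) / J ≤ 4 := div_le_self (by norm_num) (by exact_mod_cast hJ1)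
      linarith
    calc (truncProd (oddSymbol Δ) X)⁻¹
        ≤ (truncProd (oddSymbol Δ) (2 ^ J))⁻¹
          * Real.exp (2 * ∑ j ∈ Ico J (J + 1), 4 / (j : ℝ)) := h1
      _ ≤ (Real.exp 32 * (32 * (200 * Real.exp 144 * (r * ℓ) + 601 * (r * ℓ)))) * Real.exp 8 := by
          refine mul_le_mul (h2.trans ?_) (Real.exp_le_exp.mpr h6) (Real.exp_pos _).le
            (by positivity)
          refine mul_le_mul_of_nonneg_left ?_ (Real.exp_pos _).le
          linarith
      _ = eulerConst * (r * ℓ) := by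
          unfold eulerConst
          rw [show (40 : ℝ) = 32 + 8 by norm_num, Real.exp_add]
          ring

theorem oddSymbol_eq_kroneckerAtPrime {p : ℕ} (hp : p.Prime) (hp2 : p ≠ 2) :
    oddSymbol Δ p = kroneckerAtPrime Δ p := by
  rw [oddSymbol_of_odd (hp.odd_of_ne_two hp2), kroneckerAtPrime, if_neg hp2]

theorem truncProd_mul_prod_kroneckerAtPrime (Δ : ℤ) {x : ℝ} (hx : 2 ≤ x) {N : ℕ}
    (hN : ⌊x⌋₊ + 1 ≤ N) :
    truncProd (oddSymbol Δ) (⌊x⌋₊ + 1) *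
      ∏ p ∈ (range N).filter (fun p : ℕ => p.Prime ∧ x < (p : ℝ)),
        (1 - (kroneckerAtPrime Δ p : ℝ) / p) = truncProd (oddSymbol Δ) N := by
  rw [← truncProd_mul_prod_Ico _ hN]
  congr 1
  have hiff : ∀ p : ℕ, x < p ↔ ⌊x⌋₊ + 1 ≤ p := fun p => (Nat.floor_lt (by linarith)).symm
  have hset : (range N).filter (fun p : ℕ => p.Prime ∧ x < (p : ℝ))
      = ({p ∈ Ico (⌊x⌋₊ + 1) N | p.Prime} : Finset ℕ) := by
    ext p
    simp only [mem_filter, mem_range, mem_Ico, hiff]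
    tauto
  rw [hset]
  refine Finset.prod_congr rfl fun p hp => ?_
  simp only [mem_filter, mem_Ico] at hp
  have h2 : 2 ≤ ⌊x⌋₊ := Nat.le_floor (by exact_mod_cast hx)
  rw [oddSymbol_eq_kroneckerAtPrime hp.2 (by omega)]

theorem tail_le_of_tendsto (hΔ : Δ < 0) (hfund : IsFundamentalDiscriminant Δ) {x : ℝ} (hx : 2 ≤ x)
    {P : ℝ} (hP : Tendsto (fun N : ℕ => ∏ p ∈ (range N).filter (fun p : ℕ => p.Prime ∧ x < (p : ℝ)),
      (1 - (kroneckerAtPrime Δ p : ℝ) / p)) atTop (𝓝 P)) :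
    P ≤ Real.exp 32 * eulerConst * √|(Δ : ℝ)| := by
  have hm : 1 < Δ.natAbs := by
    rcases hfund with h | h <;> omega
  have hχ := abs_oddSymbol_le_one Δ
  obtain ⟨ℓ, hℓ⟩ := exists_tendsto_sum_mul_inv (abs_sum_oddSymbol_le hΔ)
  have hcard := card_smallSplit_le hΔ (fun p hp hp2 => hfund.not_sq_dvd hp hp2) hℓ
  have hone : (1 : ℝ) ≤ #(smallSplit Δ) := by
    have : 1 ∈ smallSplit Δ := by
      simp only [smallSplit, mem_filter, mem_range]
      exact ⟨hm, odd_one, by simpa using hm, Or.inl trivial⟩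
    exact_mod_cast Finset.card_pos.mpr ⟨1, this⟩
  have hF := inv_truncProd_le hΔ hm hcard (hone.trans hcard) hℓ (⌊x⌋₊ + 1)
  have habs : |(Δ : ℝ)| = (Δ.natAbs : ℝ) := by
    rw [← Int.cast_abs, Int.abs_eq_natAbs, Int.cast_natCast]
  rw [habs]
  have hr1 : 1 ≤ √(Δ.natAbs : ℝ) := Real.one_le_sqrt.mpr (by exact_mod_cast hm.le)
  have hℓ0 : 0 < ℓ := by
    by_contra! h
    nlinarith
  set F := truncProd (oddSymbol Δ) (⌊x⌋₊ + 1) with hFdef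
  have hFpos : 0 < F := truncProd_pos hχ _
  have hlim := ((hP.comp tendsto_two_pow_nat).const_mul F).mul (tendsto_lValue hχ
    (abs_sum_oddSymbol_le hΔ) hℓ)
  have hbound : F * P * ℓ ≤ Real.exp 32 := by
    refine le_of_tendsto hlim ?_
    filter_upwards [eventually_ge_atTop 1,
      tendsto_two_pow_nat.eventually_ge_atTop (⌊x⌋₊ + 1)] with J hJ1 hJ
    rw [Function.comp_apply, hFdef, truncProd_mul_prod_kroneckerAtPrime Δ hx hJ]
    exact truncProd_mul_lValue_le hχ hJ1
  have h1 : P * ℓ ≤ Real.exp 32 * F⁻¹ := by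
    rw [← div_eq_mul_inv, le_div_iff₀ hFpos]
    linarith
  have h2 : P * ℓ ≤ Real.exp 32 * eulerConst * √(Δ.natAbs : ℝ) * ℓ := by
    refine h1.trans ((mul_le_mul_of_nonneg_left hF (Real.exp_pos _).le).trans_eq ?_)
    ring
  exact le_of_mul_le_mul_right h2 hℓ0

end TruncatedProducts

end TailProduct

/-- There is an effective absolute constant `C > 0` such that for every
fundamental quadratic discriminant `Δ < 0` with associated Kronecker symbol `χ = (Δ/·)`,
and every real `x ≥ 2`, the convergent infinite product satisfies
`∏_{p > x} (1 − χ(p)/p) ≤ C · √|Δ|`.  The infinite product is expressed as the limit of its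
partial products. -/
theorem tail_prod_one_sub_chi_div_p_le :
    ∃ C : ℝ, 0 < C ∧
      ∀ Δ : ℤ, Δ < 0 → IsFundamentalDiscriminant Δ →
        ∀ x : ℝ, 2 ≤ x → ∀ P : ℝ,
          Filter.Tendsto
            (fun N : ℕ => ∏ p ∈ (Finset.range N).filter (fun p : ℕ => p.Prime ∧ x < (p : ℝ)),
              (1 - (kroneckerAtPrime Δ p : ℝ) / p))
            Filter.atTop (nhds P) →
          P ≤ C * Real.sqrt |(Δ : ℝ)| := by
  exact ⟨Real.exp 32 * eulerConst, mul_pos (Real.exp_pos _) eulerConst_pos,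
    fun _ hΔ hfund _ hx _ hP => tail_le_of_tendsto hΔ hfund hx hP⟩
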